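/- Let Γ₁ and Γ₂ be measurably freely indecomposable infinite countable groups that are not measure equivalent to each other, and let Γ'₁ ≤ Γ₁ be a subgroup of finite index κ ≥ 2. Then for any two stably orbit equivalent free p.m.p. actions α of Γ₁ * Γ₂ and β of Γ'₁ * Γ₂ * Γ₂ * ⋯ * Γ₂ (the free product of Γ'₁ with κ copies of Γ₂) on standard probability spaces, the restriction α|Γ₂ is not ergodic. -/

import Mathlib

open MeasureTheory

/-- A countable Borel equivalence relation on `X`, defined on a Borel domain `dom`:
it is Borel as a subset of `X × X`, is an equivalence relation on `dom`, and has
countable classes. -/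
structure CBER (X : Type) [MeasurableSpace X] where
  dom : Set X
  dom_meas : MeasurableSet dom
  rel : X → X → Prop
  rel_meas : MeasurableSet {p : X × X | rel p.1 p.2}
  rel_dom : ∀ {x y : X}, rel x y → x ∈ dom ∧ y ∈ dom
  refl : ∀ x ∈ dom, rel x x
  symm : ∀ {x y : X}, rel x y → rel y x
  trans : ∀ {x y z : X}, rel x y → rel y z → rel x z
  countable_classes : ∀ x : X, {y | rel x y}.Countable

/-- The class of `x`. -/
def CBER.cls {X : Type} [MeasurableSpace X] (R : CBER X) (x : X) : Set X := {y | R.rel x y}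

/-- The `R`-saturation of a set `A`: the union of the `R`-classes meeting `A`. -/
def CBER.sat {X : Type} [MeasurableSpace X] (R : CBER X) (A : Set X) : Set X :=
  {y | ∃ x ∈ A, R.rel x y}

/-- A complete section: a Borel subset of the domain meeting every class. -/
def CBER.IsCompleteSection {X : Type} [MeasurableSpace X] (R : CBER X) (A : Set X) : Prop :=
  MeasurableSet A ∧ A ⊆ R.dom ∧ ∀ x ∈ R.dom, ∃ y ∈ A, R.rel x y

/-- A smooth CBER: one admitting a Borel fundamental domain (a Borel set meeting
every class exactly once). -/
def CBER.Smooth {X : Type} [MeasurableSpace X] (R : CBER X) : Prop :=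
  ∃ D : Set X, MeasurableSet D ∧ D ⊆ R.dom ∧ ∀ x ∈ R.dom, ∃! y, y ∈ D ∧ R.rel x y

/-- Smoothness of the restriction `R|A`. -/
def CBER.SmoothOn {X : Type} [MeasurableSpace X] (R : CBER X) (A : Set X) : Prop :=
  ∃ D : Set X, MeasurableSet D ∧ D ⊆ A ∧ ∀ x ∈ R.dom ∩ A, ∃! y, y ∈ D ∧ R.rel x y

/-- All classes are finite. -/
def CBER.FiniteClasses {X : Type} [MeasurableSpace X] (R : CBER X) : Prop :=
  ∀ x ∈ R.dom, (R.cls x).Finite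

/-- Aperiodic: all classes are infinite (on the domain). -/
def CBER.Aperiodic {X : Type} [MeasurableSpace X] (R : CBER X) : Prop :=
  ∀ x ∈ R.dom, (R.cls x).Infinite

/-- Trivial: all classes are singletons. -/
def CBER.TrivialClasses {X : Type} [MeasurableSpace X] (R : CBER X) : Prop :=
  ∀ x y, R.rel x y → x = y

/-- The restriction `R|U` of `R` to a Borel set `U`. -/
def CBER.restrict {X : Type} [MeasurableSpace X] (R : CBER X) (U : Set X)
    (hU : MeasurableSet U) : CBER X where
  dom := R.dom ∩ U
  dom_meas := R.dom_meas.inter hU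
  rel x y := R.rel x y ∧ x ∈ U ∧ y ∈ U
  rel_meas := by
    have h : {p : X × X | R.rel p.1 p.2 ∧ p.1 ∈ U ∧ p.2 ∈ U} =
        {p : X × X | R.rel p.1 p.2} ∩ (Prod.fst ⁻¹' U ∩ Prod.snd ⁻¹' U) := by
      ext p
      simp only [Set.mem_setOf_eq, Set.mem_inter_iff, Set.mem_preimage, and_assoc]
    rw [h]
    exact R.rel_meas.inter ((measurable_fst hU).inter (measurable_snd hU))
  rel_dom := fun h => ⟨⟨(R.rel_dom h.1).1, h.2.1⟩, ⟨(R.rel_dom h.1).2, h.2.2⟩⟩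
  refl := fun x hx => ⟨R.refl x hx.1, hx.2, hx.2⟩
  symm := fun h => ⟨R.symm h.1, h.2.2, h.2.1⟩
  trans := fun h h' => ⟨R.trans h.1 h'.1, h.2.1, h'.2.2⟩
  countable_classes := fun x =>
    Set.Countable.mono (fun y hy => hy.1) (R.countable_classes x)

/-- `S` is a subrelation of `R`. -/
def CBER.IsSubrelOf {X : Type} [MeasurableSpace X] (S R : CBER X) : Prop :=
  S.dom ⊆ R.dom ∧ ∀ x y, S.rel x y → R.rel x y

/-- A partial Borel isomorphism between Borel subsets `src` and `tgt` of `X`. -/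
structure PBI (X : Type) [MeasurableSpace X] where
  src : Set X
  tgt : Set X
  src_meas : MeasurableSet src
  tgt_meas : MeasurableSet tgt
  toFun : X → X
  invFun : X → X
  meas_toFun : Measurable toFun
  meas_invFun : Measurable invFun
  mapsTo : Set.MapsTo toFun src tgt
  mapsTo_inv : Set.MapsTo invFun tgt src
  left_inv : ∀ x ∈ src, invFun (toFun x) = x
  right_inv : ∀ y ∈ tgt, toFun (invFun y) = y

/-- Membership in the full pseudogroup `[[R]]`: a partial Borel isomorphism whose
graph is contained in `R`. -/
def CBER.InPseudogroup {X : Type} [MeasurableSpace X] (R : CBER X) (φ : PBI X) : Prop :=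
  φ.src ⊆ R.dom ∧ ∀ x ∈ φ.src, R.rel x (φ.toFun x)

/-- Two subrelations `S₁`, `S₂` of `R` are inner conjugate in `R` if some element of the
full pseudogroup of `R` with domain `D(S₂)` and target `D(S₁)` conjugates one to the other. -/
def InnerConjugate {X : Type} [MeasurableSpace X] (R S₁ S₂ : CBER X) : Prop :=
  ∃ φ : PBI X, R.InPseudogroup φ ∧ φ.src = S₂.dom ∧ φ.tgt = S₁.dom ∧
    ∀ x ∈ φ.src, ∀ y ∈ φ.src, (S₂.rel x y ↔ S₁.rel (φ.toFun x) (φ.toFun y))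

/-- `R` preserves the measure `μ`: every element of its full pseudogroup preserves `μ`. -/
def CBER.IsPMP {X : Type} [MeasurableSpace X] (R : CBER X) (μ : Measure X) : Prop :=
  ∀ φ : PBI X, R.InPseudogroup φ → ∀ A : Set X, A ⊆ φ.src → MeasurableSet A →
    μ (φ.toFun '' A) = μ A

/-- Free independence of a family of equivalence relations: any cycle alternating
nontrivially among the factors must have two consecutive steps in the same factor. -/
def FreelyIndep {X : Type} [MeasurableSpace X] {ι : Type} (Rf : ι → CBER X) : Prop :=
  ∀ (n : ℕ) (x : ℕ → X) (i : ℕ → ι), 2 ≤ n → x n = x 0 →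
    (∀ j < n, x j ≠ x (j + 1)) → (∀ j < n, (Rf (i j)).rel (x j) (x (j + 1))) →
    ∃ j, j + 1 < n ∧ i j = i (j + 1)

/-- `R` is the free product of the family `Rf`: the family is freely independent and `R`
is the smallest equivalence relation on the union of the domains containing every `Rf i`. -/
def IsFreeProduct {X : Type} [MeasurableSpace X] {ι : Type} (R : CBER X)
    (Rf : ι → CBER X) : Prop :=
  FreelyIndep Rf ∧ R.dom = (⋃ i, (Rf i).dom) ∧
    ∀ x y, R.rel x y ↔
      (x ∈ R.dom ∧ Relation.EqvGen (fun a b => ∃ i, (Rf i).rel a b) x y)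

/-- The partition `U = ⊔ⱼ Uⱼ` trivializes the free product decomposition `R = *ⱼ Rf j`:
`U` is a complete section for `R`, the partition is `R|U`-invariant, and
`R|Uⱼ = (Rf j)|Uⱼ` for every `j`. -/
def Trivializes {X : Type} [MeasurableSpace X] {ι : Type}
    (R : CBER X) (Rf : ι → CBER X) (U : ι → Set X) : Prop :=
  (∀ j, MeasurableSet (U j)) ∧ (∀ j, U j ⊆ R.dom) ∧
  Pairwise (Function.onFun Disjoint U) ∧
  (∀ x ∈ R.dom, ∃ y ∈ ⋃ j, U j, R.rel x y) ∧
  (∀ i j : ι, ∀ x ∈ U i, ∀ y ∈ U j, R.rel x y → i = j) ∧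
  (∀ j, ∀ x ∈ U j, ∀ y ∈ U j, (R.rel x y ↔ (Rf j).rel x y))

/-- A free product decomposition is inessential if it admits a trivialization. -/
def Inessential {X : Type} [MeasurableSpace X] {ι : Type}
    (R : CBER X) (Rf : ι → CBER X) : Prop :=
  ∃ U : ι → Set X, Trivializes R Rf U

/-- Freely indecomposable (Borel context): every free product decomposition is inessential. -/
def FreelyIndecomposable {X : Type} [MeasurableSpace X] (R : CBER X) : Prop :=
  ∀ (ι : Type) (_ : Countable ι) (Rf : ι → CBER X), IsFreeProduct R Rf → Inessential R Rf

/-- Inessential decomposition in the measured context: a trivialization up to `μ`-null sets. -/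
def InessentialMod {X : Type} [MeasurableSpace X] (μ : Measure X) {ι : Type}
    (R : CBER X) (Rf : ι → CBER X) : Prop :=
  ∃ (U : ι → Set X) (C : Set X),
    (∀ j, MeasurableSet (U j)) ∧ (∀ j, U j ⊆ R.dom) ∧
    Pairwise (Function.onFun Disjoint U) ∧
    MeasurableSet C ∧ μ Cᶜ = 0 ∧
    (∀ x ∈ R.dom ∩ C, ∃ y ∈ ⋃ j, U j, R.rel x y) ∧
    (∀ i j : ι, ∀ x ∈ U i ∩ C, ∀ y ∈ U j ∩ C, R.rel x y → i = j) ∧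
    (∀ j, ∀ x ∈ U j ∩ C, ∀ y ∈ U j ∩ C, (R.rel x y ↔ (Rf j).rel x y))

/-- Freely indecomposable (measured context): every free product decomposition is
inessential up to `μ`-null sets. -/
def FreelyIndecomposableMod {X : Type} [MeasurableSpace X] (μ : Measure X)
    (R : CBER X) : Prop :=
  ∀ (ι : Type) (_ : Countable ι) (Rf : ι → CBER X), IsFreeProduct R Rf →
    InessentialMod μ R Rf

/-- One step of a word in a graphing: apply `φ` (if `e = true`) or `φ⁻¹` (if `e = false`). -/
def PBIStep {X : Type} [MeasurableSpace X] (φ : PBI X) : Bool → X → X → Prop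
  | true, a, b => a ∈ φ.src ∧ φ.toFun a = b
  | false, a, b => a ∈ φ.tgt ∧ φ.invFun a = b

/-- A treeing: any cyclic word in the generators and their inverses admits a reduction. -/
def IsTreeing {X : Type} [MeasurableSpace X] {ι : Type} (Φ : ι → PBI X) : Prop :=
  ∀ (n : ℕ) (i : ℕ → ι) (ε : ℕ → Bool) (x : ℕ → X),
    0 < n → x n = x 0 → (∀ j < n, PBIStep (Φ (i j)) (ε j) (x j) (x (j + 1))) →
    ∃ j, j + 1 < n ∧ i j = i (j + 1) ∧ ε j ≠ ε (j + 1)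

/-- The graphing `Φ` generates `R`: `R` is the smallest equivalence relation on the union of
the sources and targets containing the graphs of the `Φ i`. -/
def GeneratesCBER {X : Type} [MeasurableSpace X] {ι : Type} (Φ : ι → PBI X)
    (R : CBER X) : Prop :=
  R.dom = (⋃ i, ((Φ i).src ∪ (Φ i).tgt)) ∧ (∀ i, R.InPseudogroup (Φ i)) ∧
    ∀ x y, R.rel x y ↔ (x ∈ R.dom ∧
      Relation.EqvGen (fun a b => ∃ i, a ∈ (Φ i).src ∧ (Φ i).toFun a = b) x y)

/-- Treeable: generated by some (countable) treeing. -/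
def CBER.Treeable {X : Type} [MeasurableSpace X] (R : CBER X) : Prop :=
  ∃ Φ : ℕ → PBI X, IsTreeing Φ ∧ GeneratesCBER Φ R

/-- Hyperfinite: increasing union of finite Borel subrelations. -/
def CBER.Hyperfinite {X : Type} [MeasurableSpace X] (R : CBER X) : Prop :=
  ∃ S : ℕ → CBER X, (∀ n, (S n).IsSubrelOf R) ∧ (∀ n, (S n).FiniteClasses) ∧
    (∀ n, (S n).dom = R.dom) ∧ (∀ n, ∀ x y, (S n).rel x y → (S (n + 1)).rel x y) ∧
    ∀ x y, R.rel x y → ∃ n, (S n).rel x y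

/-- Ergodicity of a measured CBER: every invariant Borel set is null or conull. -/
def ErgodicCBER {X : Type} [MeasurableSpace X] (R : CBER X) (μ : Measure X) : Prop :=
  ∀ A : Set X, MeasurableSet A → (∀ x ∈ A, ∀ y, R.rel x y → y ∈ A) →
    μ A = 0 ∨ μ Aᶜ = 0

/-- A stable orbit equivalence between measured CBERs: a Borel isomorphism between
complete sections (mod null sets), sending the normalized measure to the normalized
measure, and preserving the relations a.e. -/
structure SOEquiv {X Y : Type} [MeasurableSpace X] [MeasurableSpace Y]
    (R : CBER X) (μ : Measure X) (S : CBER Y) (ν : Measure Y) where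
  A : Set X
  B : Set Y
  toFun : X → Y
  invFun : Y → X
  measA : MeasurableSet A
  measB : MeasurableSet B
  A_sub : A ⊆ R.dom
  B_sub : B ⊆ S.dom
  A_pos : 0 < μ A
  B_pos : 0 < ν B
  A_section : ∀ᵐ x ∂μ, x ∈ R.dom → ∃ y ∈ A, R.rel x y
  B_section : ∀ᵐ y ∂ν, y ∈ S.dom → ∃ z ∈ B, S.rel y z
  meas_toFun : Measurable toFun
  meas_invFun : Measurable invFun
  mapsTo : Set.MapsTo toFun A B
  mapsTo_inv : Set.MapsTo invFun B A
  left_inv : ∀ x ∈ A, invFun (toFun x) = x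
  right_inv : ∀ y ∈ B, toFun (invFun y) = y
  measure_eq : ∀ E : Set X, E ⊆ A → MeasurableSet E →
    (μ A)⁻¹ * μ E = (ν B)⁻¹ * ν (toFun '' E)
  rel_iff : ∃ C : Set X, MeasurableSet C ∧ μ (A \ C) = 0 ∧
    ∀ x ∈ A ∩ C, ∀ y ∈ A ∩ C, (R.rel x y ↔ S.rel (toFun x) (toFun y))

/-- Stable orbit equivalence. -/
def SOE {X Y : Type} [MeasurableSpace X] [MeasurableSpace Y]
    (R : CBER X) (μ : Measure X) (S : CBER Y) (ν : Measure Y) : Prop :=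
  Nonempty (SOEquiv R μ S ν)

/-- Orbit equivalence: a stable orbit equivalence where one can take the complete
sections to be the full spaces. -/
def OE {X Y : Type} [MeasurableSpace X] [MeasurableSpace Y]
    (R : CBER X) (μ : Measure X) (S : CBER Y) (ν : Measure Y) : Prop :=
  ∃ E : SOEquiv R μ S ν, E.A = Set.univ ∧ E.B = Set.univ

/-- A probability measure preserving action of a group `G` on a measured space. -/
structure PMPAction (G : Type) [Group G] (X : Type) [MeasurableSpace X]
    (μ : Measure X) where
  act : G → X → X
  act_one : ∀ x, act 1 x = x
  act_mul : ∀ g h x, act (g * h) x = act g (act h x)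
  measurePreserving : ∀ g, MeasurePreserving (act g) μ μ

/-- Essential freeness: a.e. point has trivial stabilizer. -/
def PMPAction.IsFree {G X : Type} [Group G] [MeasurableSpace X] {μ : Measure X}
    (α : PMPAction G X μ) : Prop :=
  ∀ᵐ x ∂μ, ∀ g : G, α.act g x = x → g = 1

/-- `R` is the orbit equivalence relation of the action `α` restricted to the subgroup `H`. -/
def IsOrbitRel {G X : Type} [Group G] [MeasurableSpace X] {μ : Measure X}
    (α : PMPAction G X μ) (H : Subgroup G) (R : CBER X) : Prop :=
  R.dom = Set.univ ∧ ∀ x y, (R.rel x y ↔ ∃ g ∈ H, α.act g x = y)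

/-- A countable group is measurably freely indecomposable (MFI) if the orbit equivalence
relation of every free p.m.p. action of it on a standard probability space is freely
indecomposable. -/
def MFI (G : Type) [Group G] [Countable G] : Prop :=
  ∀ (X : Type) [MeasurableSpace X] [StandardBorelSpace X]
    (μ : Measure X) [IsProbabilityMeasure μ]
    (α : PMPAction G X μ) (R : CBER X),
    α.IsFree → IsOrbitRel α ⊤ R → FreelyIndecomposableMod μ R

/-- `G` is the internal free product of the family of subgroups `H`. -/
def IsFreeProductOf (G : Type) [Group G] {ι : Type} (H : ι → Subgroup G) : Prop :=
  Function.Bijective (Monoid.CoprodI.lift fun i => (H i).subtype)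

/-- A Borel fundamental domain for an action, of the coupling kind: meets a.e. orbit,
and meets each orbit at most once mod null. -/
def IsFundamentalDomainFor {G : Type} [Group G] {Ω : Type} [MeasurableSpace Ω]
    (ν : Measure Ω) (a : G → Ω → Ω) (D : Set Ω) : Prop :=
  MeasurableSet D ∧ (∀ᵐ x ∂ν, ∃ g : G, a g x ∈ D) ∧
    ∀ g : G, g ≠ 1 → ν (D ∩ a g ⁻¹' D) = 0

/-- A measure equivalence coupling between `G` and `H`: a standard σ-finite measure space
with commuting measure-preserving essentially free actions of `G` and `H`, each admitting
a Borel fundamental domain of finite positive measure. -/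
structure MECoupling (G : Type) [Group G] (H : Type) [Group H] where
  (Ω : Type)
  [mΩ : MeasurableSpace Ω]
  [sbΩ : StandardBorelSpace Ω]
  (ν : Measure Ω)
  sigmaFinite : SigmaFinite ν
  aG : G → Ω → Ω
  aH : H → Ω → Ω
  DG : Set Ω
  DH : Set Ω
  aG_one : ∀ x, aG 1 x = x
  aG_mul : ∀ g g' x, aG (g * g') x = aG g (aG g' x)
  aH_one : ∀ x, aH 1 x = x
  aH_mul : ∀ h h' x, aH (h * h') x = aH h (aH h' x)
  comm : ∀ g h x, aG g (aH h x) = aH h (aG g x)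
  mp_aG : ∀ g, MeasurePreserving (aG g) ν ν
  mp_aH : ∀ h, MeasurePreserving (aH h) ν ν
  free_aG : ∀ᵐ x ∂ν, ∀ g, aG g x = x → g = 1
  free_aH : ∀ᵐ x ∂ν, ∀ h, aH h x = x → h = 1
  fund_DG : IsFundamentalDomainFor ν aG DG
  fund_DH : IsFundamentalDomainFor ν aH DH
  DG_pos : 0 < ν DG
  DG_fin : ν DG < ⊤
  DH_pos : 0 < ν DH
  DH_fin : ν DH < ⊤

/-- The generalized index (compression constant) of a measure equivalence coupling. -/
noncomputable def MECoupling.index {G : Type} [Group G] {H : Type} [Group H]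
    (c : MECoupling G H) : ENNReal :=
  c.ν c.DH / c.ν c.DG

/-- Measure equivalence of countable groups. -/
def MeasureEquivalent (G : Type) [Group G] (H : Type) [Group H] : Prop :=
  Nonempty (MECoupling G H)

/-- Measure equivalence with a prescribed generalized index. -/
def MEwithIndex (G : Type) [Group G] (H : Type) [Group H] (κ : ENNReal) : Prop :=
  ∃ c : MECoupling G H, c.index = κ

namespace IsFreeProductOf

variable {H : Type} [Group H] {ι : Type} {B : ι → Subgroup H}

/-- Every element of an internal free product is obtained from `1` by successive left
multiplications by elements of the factors. -/
theorem induction_left (hB : IsFreeProductOf H B) {P : H → Prop} (one : P 1)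
    (mul : ∀ i, ∀ b ∈ B i, ∀ h, P h → P (b * h)) (h : H) : P h := by
  obtain ⟨w, rfl⟩ := hB.2 h
  induction w using Monoid.CoprodI.induction_left with
  | one => simpa using one
  | mul b w hw =>
    rw [map_mul, Monoid.CoprodI.lift_of]
    exact mul _ _ b.2 _ hw

/-- The retraction of a free product onto one of its factors `B i` given by the syllable in `B i`
at the end of a reduced word: it is insensitive to left multiplications by elements of factors,
except for those by elements of `B i` on `B i` itself. -/
theorem exists_retraction (hB : IsFreeProductOf H B) (i : ι) :
    ∃ ρ : H → H, (∀ b ∈ B i, ρ b = b) ∧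
      (∀ j, ∀ b ∈ B j, ∀ h, (j ≠ i ∨ h ∉ B i) → ρ (b * h) = ρ h) ∧
      (∀ h, ∀ b ∈ B i, ρ (h * b) = ρ h * b) := by
  classical
  let φ : ∀ j, B j →* Function.End (H × H) := fun j =>
    { toFun := fun b p => (b * p.1, if j = i ∧ p.1 ∈ B i then b * p.2 else p.2)
      map_one' := by
        funext p
        simp [Function.End.one_def]
      map_mul' := by
        intro b c
        funext p
        have hmem : j = i → ((c : H) * p.1 ∈ B i ↔ p.1 ∈ B i) := by
          rintro rfl
          exact Subgroup.mul_mem_cancel_left _ c.2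
        change _ = (((b : H) * ((c : H) * p.1), if j = i ∧ (c : H) * p.1 ∈ B i then
          (b : H) * (if j = i ∧ p.1 ∈ B i then (c : H) * p.2 else p.2) else
          if j = i ∧ p.1 ∈ B i then (c : H) * p.2 else p.2) : H × H)
        by_cases hj : j = i
        · by_cases hp : p.1 ∈ B i
          · simp only [hj, hp, hmem hj, mul_assoc, Subgroup.coe_mul, and_self, if_true]
          · simp only [hj, hp, hmem hj, mul_assoc, Subgroup.coe_mul, and_false, if_false]
        · simp only [hj, mul_assoc, Subgroup.coe_mul, false_and, if_false] }
  let E := MulEquiv.ofBijective _ hB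
  obtain ⟨Φ, hone, hstep⟩ : ∃ Φ : H → H × H → H × H, (∀ p, Φ 1 p = p) ∧
      ∀ j, ∀ b ∈ B j, ∀ h p, Φ (b * h) p =
        (b * (Φ h p).1, if j = i ∧ (Φ h p).1 ∈ B i then b * (Φ h p).2 else (Φ h p).2) := by
    refine ⟨fun h => (Monoid.CoprodI.lift φ) (E.symm h), fun p => ?_, fun j b hb h p => ?_⟩
    · change (Monoid.CoprodI.lift φ) (E.symm 1) p = p
      rw [map_one, map_one]
      rfl
    · have hsymm : E.symm b = Monoid.CoprodI.of (M := fun i => B i) (i := j) ⟨b, hb⟩ := by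
        rw [MulEquiv.symm_apply_eq]
        exact (Monoid.CoprodI.lift_of (M := fun i => B i) (fun i => (B i).subtype) ⟨b, hb⟩).symm
      change (Monoid.CoprodI.lift φ) (E.symm (b * h)) p = _
      rw [map_mul, hsymm, map_mul, Monoid.CoprodI.lift_of]
      rfl
  have hfst : ∀ h p, (Φ h p).1 = h * p.1 := by
    intro h p
    refine hB.induction_left (P := fun h => (Φ h p).1 = h * p.1) ?_ ?_ h
    · rw [hone, one_mul]
    · intro j b hb h ih
      rw [hstep j b hb, ih, mul_assoc]
  have hmul : ∀ j, ∀ b ∈ B j, ∀ h, (Φ (b * h) (1, 1)).2 =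
      if j = i ∧ h ∈ B i then b * (Φ h (1, 1)).2 else (Φ h (1, 1)).2 := by
    intro j b hb h
    rw [hstep j b hb, hfst]
    simp
  have hself : ∀ b ∈ B i, (Φ b (1, 1)).2 = b := by
    intro b hb
    have := hmul i b hb 1
    rw [hone] at this
    simpa [one_mem] using this
  refine ⟨fun h => (Φ h (1, 1)).2, hself, ?_, ?_⟩
  · intro j b hb h hjh
    beta_reduce
    rw [hmul j b hb, if_neg]
    rintro ⟨rfl, hh⟩
    exact hjh.elim (fun H => H rfl) (fun H => H hh)
  · intro h b hb
    refine hB.induction_left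
      (P := fun h => (Φ (h * b) (1, 1)).2 = (Φ h (1, 1)).2 * b) ?_ ?_ h
    · rw [one_mul, hself b hb, hone, one_mul]
    · intro j c hc h ih
      rw [mul_assoc, hmul j c hc, hmul j c hc, ih, Subgroup.mul_mem_cancel_right _ hb]
      split_ifs <;> simp [mul_assoc]

/-- Factors of a free product are malnormal, and distinct factors have no nontrivial conjugate
elements. -/
theorem eq_and_mem_of_conj (hB : IsFreeProductOf H B) {k o : ι} {b c w : H}
    (hb : b ∈ B k) (hc : c ∈ B o) (hb1 : b ≠ 1) (h : w * b = c * w) : o = k ∧ w ∈ B k := by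
  obtain ⟨ρ, -, h2, h3⟩ := hB.exists_retraction k
  by_contra hcon
  have hcon' : o ≠ k ∨ w ∉ B k := by tauto
  have := h3 w b hb
  rw [h, h2 o c hc w hcon'] at this
  exact hb1 (left_eq_mul.mp this)

end IsFreeProductOf

/-- A family of relations is freely independent as soon as every class of every member admits a
retraction which is constant along all the other classes. -/
theorem freelyIndep_of_retractions {X : Type} [MeasurableSpace X] {ι : Type} (Rf : ι → CBER X)
    (hr : ∀ i x, ∃ r : X → X, (∀ u, (Rf i).rel x u → r u = u) ∧
      ∀ j u u', (Rf j).rel u u' → (j = i → ¬ (Rf i).rel x u) → r u = r u') :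
    FreelyIndep Rf := by
  intro n
  induction n using Nat.strong_induction_on with
  | _ n ih =>
  intro x i hn hcyc hne hrel
  obtain ⟨r, hr1, hr2⟩ := hr (i 0) (x 0)
  have h01 := hrel 0 (by omega)
  have hx0 : r (x 0) = x 0 := hr1 _ ((Rf _).refl _ ((Rf _).rel_dom h01).1)
  have hx1 : r (x 1) = x 1 := hr1 _ h01
  have hex : ∃ k, 1 ≤ k ∧ k < n ∧ r (x k) ≠ r (x (k + 1)) := by
    by_contra hcon
    push Not at hcon
    have hall : ∀ k, 1 ≤ k → k ≤ n → r (x k) = r (x 1) := by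
      intro k hk
      induction k, hk using Nat.le_induction with
      | base => intro; rfl
      | succ k hk IH =>
        intro hkn
        rw [← hcon k hk (by omega)]
        exact IH (by omega)
    have := hall n (by omega) le_rfl
    rw [hcyc, hx0, hx1] at this
    exact hne 0 (by omega) this
  classical
  obtain ⟨hk1, hkn, hkr⟩ := Nat.find_spec hex
  set k := Nat.find hex
  have hmin : ∀ l, 1 ≤ l → l < k → r (x l) = r (x (l + 1)) := by
    intro l hl hlk
    by_contra hcon
    exact Nat.find_min hex hlk ⟨hl, by omega, hcon⟩
  have hall : ∀ l, 1 ≤ l → l ≤ k → r (x l) = r (x 1) := by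
    intro l hl
    induction l, hl using Nat.le_induction with
    | base => intro; rfl
    | succ l hl IH =>
      intro hlk
      rw [← hmin l hl (by omega)]
      exact IH (by omega)
  have hstep : i k = i 0 ∧ (Rf (i 0)).rel (x 0) (x k) := by
    by_contra hcon
    exact hkr (hr2 (i k) _ _ (hrel k hkn) (by tauto))
  have hxk : x k = x 1 := by
    rw [← hr1 _ hstep.2, hall k hk1 le_rfl, hx1]
  rcases Nat.lt_or_ge 1 k with hk | hk
  · have hk2 : 2 ≤ k - 1 := by
      by_contra hcon
      have hk2 : k = 2 := by omega
      exact hne 1 (by omega) (by rw [← hxk, hk2])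
    obtain ⟨j, hj, hij⟩ := ih (k - 1) (by omega) (fun l => x (l + 1)) (fun l => i (l + 1)) hk2
      (by simp only [Nat.sub_add_cancel hk1]; simpa using hxk)
      (fun j hj => hne (j + 1) (by omega)) (fun j hj => hrel (j + 1) (by omega))
    exact ⟨j + 1, by omega, hij⟩
  · have : k = 1 := by omega
    exact ⟨0, by omega, by rw [← hstep.1, this]⟩

section FirstChoice

/-- The first element of a subset of a countable type, for some fixed enumeration of the type. -/
noncomputable def firstOf {κ : Type} [Countable κ] [Nonempty κ] (S : Set κ) : κ :=
  Function.invFun (exists_injective_nat κ).choose (sInf ((exists_injective_nat κ).choose '' S))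

theorem firstOf_mem {κ : Type} [Countable κ] [Nonempty κ] {S : Set κ} (hS : S.Nonempty) :
    firstOf S ∈ S := by
  have hinj := (exists_injective_nat κ).choose_spec
  obtain ⟨k, hk, hk'⟩ := Nat.sInf_mem (hS.image (exists_injective_nat κ).choose)
  rw [firstOf, ← hk', Function.leftInverse_invFun hinj]
  exact hk

variable {W : Type} [MeasurableSpace W]

theorem measurable_sInf_nat {P : W → ℕ → Prop} (hP : ∀ n, MeasurableSet {w | P w n}) :
    Measurable fun w => sInf {n | P w n} := by
  refine measurable_to_countable' fun n => ?_
  have : (fun w => sInf {n | P w n}) ⁻¹' {n} =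
      ({w | P w n} ∩ ⋂ m, ⋂ _ : m < n, {w | P w m}ᶜ) ∪
        ({w | n = 0} ∩ ⋂ m, {w | P w m}ᶜ) := by
    ext w
    simp only [Set.mem_preimage, Set.mem_singleton_iff, Set.mem_union, Set.mem_inter_iff,
      Set.mem_ofPred_eq, Set.mem_iInter, Set.mem_compl_iff]
    constructor
    · rintro rfl
      rcases Set.eq_empty_or_nonempty {n | P w n} with h | h
      · right
        refine ⟨by rw [h, Nat.sInf_empty], fun m hm => ?_⟩
        exact (h.le : {n | P w n} ⊆ ∅) hm
      · left
        exact ⟨Nat.sInf_mem h, fun m hm => Nat.notMem_of_lt_sInf hm⟩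
    · rintro (⟨h, h'⟩ | ⟨rfl, h⟩)
      · refine le_antisymm (Nat.sInf_le h) ?_
        by_contra hcon
        exact h' _ (not_le.mp hcon) (Nat.sInf_mem (s := {n | P w n}) ⟨n, h⟩)
      · have : {n | P w n} = ∅ := Set.eq_empty_of_forall_notMem h
        rw [this, Nat.sInf_empty]
  rw [this]
  refine ((hP n).inter (.iInter fun m => .iInter fun _ => (hP m).compl)).union
    ((MeasurableSet.const _).inter (.iInter fun m => (hP m).compl))

variable {κ : Type} [Countable κ] [Nonempty κ]

theorem measurableSet_firstOf_eq {P : W → κ → Prop} (hP : ∀ k, MeasurableSet {w | P w k}) (k : κ) :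
    MeasurableSet {w | firstOf {k | P w k} = k} := by
  have h := measurable_sInf_nat (P := fun w n => ∃ k, P w k ∧
    (exists_injective_nat κ).choose k = n) (fun n => by
      have : {w | ∃ k, P w k ∧ (exists_injective_nat κ).choose k = n} =
          ⋃ k, {w | P w k} ∩ {w | (exists_injective_nat κ).choose k = n} := by
        ext w; simp
      rw [this]
      exact .iUnion fun k => (hP k).inter (.const _))
  exact h (MeasurableSet.of_discrete
    (s := {n | Function.invFun (exists_injective_nat κ).choose n = k}))

theorem measurableSet_of_firstOf {P Q : W → κ → Prop} (hP : ∀ k, MeasurableSet {w | P w k})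
    (hQ : ∀ k, MeasurableSet {w | Q w k}) : MeasurableSet {w | Q w (firstOf {k | P w k})} := by
  have : {w | Q w (firstOf {k | P w k})} =
      ⋃ k, {w | firstOf {k | P w k} = k} ∩ {w | Q w k} := by
    ext w; simp
  rw [this]
  exact .iUnion fun k => (measurableSet_firstOf_eq hP k).inter (hQ k)

theorem measurable_of_firstOf {Z : Type} [MeasurableSpace Z] {P : W → κ → Prop} {F : W → κ → Z}
    (hP : ∀ k, MeasurableSet {w | P w k}) (hF : ∀ k, Measurable fun w => F w k) :
    Measurable fun w => F w (firstOf {k | P w k}) := fun _ hT =>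
  measurableSet_of_firstOf (Q := fun w k => F w k ∈ _) hP fun k => hF k hT

end FirstChoice

/-- A countable-to-one Borel map `f` between a Borel `Γ`-space and a Borel `H`-space which sends
`Γ`-orbits into free `H`-orbits, where `H` is a free product of the subgroups `B i`. The sections
`s n` reconstruct `x` from `f x` and the code `e x`. -/
structure TreeMap (Γ H X Y ι : Type) [Group Γ] [Group H] [MulAction Γ X] [MulAction H Y]
    [MeasurableSpace X] [MeasurableSpace Y] where
  B : ι → Subgroup H
  freeProduct : IsFreeProductOf H B
  f : X → Y
  e : X → ℕ
  s : ℕ → Y → X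
  measurable_f : Measurable f
  measurable_e : Measurable e
  measurable_s : ∀ n, Measurable (s n)
  s_eq : ∀ x, s (e x) (f x) = x
  hom : ∀ (γ : Γ) x, ∃ h : H, h • f x = f (γ • x)
  free : ∀ (h : H) x, h • f x = f x → h = 1

theorem measurable_nat_apply {W Z : Type} [MeasurableSpace W] [MeasurableSpace Z] {N : W → ℕ}
    {F : ℕ → W → Z} (hN : Measurable N) (hF : ∀ n, Measurable (F n)) :
    Measurable fun w => F (N w) w := by
  intro T hT
  have : (fun w => F (N w) w) ⁻¹' T = ⋃ n, N ⁻¹' {n} ∩ F n ⁻¹' T := by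
    ext w; simp
  rw [this]
  exact .iUnion fun n => (hN (.singleton n)).inter (hF n hT)

namespace TreeMap

variable {Γ H X Y ι : Type} [Group Γ] [Group H] [MulAction Γ X] [MulAction H Y]
  [MeasurableSpace X] [MeasurableSpace Y] (T : TreeMap Γ H X Y ι)

/-- The letters of `H`: the elements of the factors. -/
abbrev Letter : Type := Σ i, T.B i

/-- The point `y` is moved by a word with `n` letters into the image of the orbit of `x`. -/
def lev : ℕ → X → Y → Prop
  | 0, x, y => ∃ γ : Γ, T.f (γ • x) = y
  | n + 1, x, y => ∃ l : T.Letter, lev n x ((l.2 : H) • y)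

/-- The distance of `y` to the image of the orbit of `x`. -/
noncomputable def dist (x : X) (y : Y) : ℕ := sInf {n | T.lev n x y}

/-- The preferred preimage of `y` in the orbit of `x`. -/
noncomputable def base (x : X) (y : Y) : X :=
  T.s (sInf {n | ∃ γ : Γ, T.f (γ • x) = y ∧ T.e (γ • x) = n}) y

instance [Nonempty ι] : Nonempty T.Letter := ⟨⟨Classical.arbitrary ι, 1⟩⟩

section
variable [Countable H] [Countable ι] [Nonempty ι]

/-- Auxiliary recursion for `TreeMap.proj`. -/
noncomputable def projN : ℕ → X → Y → X
  | 0, x, y => T.base x y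
  | n + 1, x, y =>
    projN n x (((firstOf {l : T.Letter | T.lev n x ((l.2 : H) • y)}).2 : H) • y)

/-- The projection of `y` to the orbit of `x` along a geodesic. -/
noncomputable def proj (x : X) (y : Y) : X := T.projN (T.dist x y) x y

end

theorem lev_smul (γ : Γ) (n : ℕ) (x : X) (y : Y) : T.lev n (γ • x) y ↔ T.lev n x y := by
  induction n generalizing y with
  | zero =>
    constructor
    · rintro ⟨δ, h⟩
      exact ⟨δ * γ, by rwa [mul_smul]⟩
    · rintro ⟨δ, h⟩
      exact ⟨δ * γ⁻¹, by rwa [mul_smul, inv_smul_smul]⟩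
  | succ n ih => simp only [lev, ih]

theorem dist_smul (γ : Γ) (x : X) (y : Y) : T.dist (γ • x) y = T.dist x y := by
  simp only [dist, lev_smul]

theorem base_smul (γ : Γ) (x : X) (y : Y) : T.base (γ • x) y = T.base x y := by
  have : {n | ∃ δ : Γ, T.f (δ • γ • x) = y ∧ T.e (δ • γ • x) = n} =
      {n | ∃ δ : Γ, T.f (δ • x) = y ∧ T.e (δ • x) = n} := by
    ext n
    constructor
    · rintro ⟨δ, h⟩
      exact ⟨δ * γ, by rwa [mul_smul]⟩
    · rintro ⟨δ, h⟩
      exact ⟨δ * γ⁻¹, by rwa [mul_smul, inv_smul_smul]⟩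
  rw [base, base, this]

theorem f_mem (γ : Γ) (x : X) : ∃ h : H, T.f (γ • x) = h • T.f x :=
  let ⟨h, hh⟩ := T.hom γ x
  ⟨h, hh.symm⟩

theorem base_spec {x : X} {y : Y} (h : T.lev 0 x y) :
    ∃ γ : Γ, T.base x y = γ • x ∧ T.f (γ • x) = y := by
  obtain ⟨γ, hγ⟩ := h
  have hne : {n | ∃ γ : Γ, T.f (γ • x) = y ∧ T.e (γ • x) = n}.Nonempty := ⟨_, γ, hγ, rfl⟩
  obtain ⟨δ, h1, h2⟩ := Nat.sInf_mem hne
  refine ⟨δ, ?_, h1⟩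
  rw [base, ← h2]
  conv_lhs => rw [← h1]
  exact T.s_eq _

theorem exists_lev (x : X) (h : H) : ∃ n, T.lev n x (h • T.f x) := by
  have key : ∀ h : H, ∀ y, (∃ n, T.lev n x (h • y)) → ∃ n, T.lev n x y := by
    intro h y
    refine T.freeProduct.induction_left
      (P := fun h => (∃ n, T.lev n x (h • y)) → ∃ n, T.lev n x y) (by simp) ?_ h
    rintro i b hb h ih ⟨n, hn⟩
    exact ih ⟨n + 1, ⟨i, b, hb⟩, by rwa [← mul_smul]⟩
  exact key h⁻¹ _ ⟨0, 1, by simp⟩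

theorem dist_le {n : ℕ} {x : X} {y : Y} (h : T.lev n x y) : T.dist x y ≤ n := Nat.sInf_le h

theorem lev_dist {x : X} {y : Y} (hy : ∃ h : H, y = h • T.f x) : T.lev (T.dist x y) x y := by
  obtain ⟨h, rfl⟩ := hy
  exact Nat.sInf_mem (T.exists_lev x h)

section
variable [Countable H] [Countable ι] [Nonempty ι]

theorem proj_smul (γ : Γ) (x : X) (y : Y) : T.proj (γ • x) y = T.proj x y := by
  have : ∀ n y, T.projN n (γ • x) y = T.projN n x y := by
    intro n
    induction n with
    | zero => exact T.base_smul γ x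
    | succ n ih =>
      intro y
      have hs : {l : T.Letter | T.lev n (γ • x) ((l.2 : H) • y)} =
          {l : T.Letter | T.lev n x ((l.2 : H) • y)} := by
        simp only [lev_smul]
      rw [projN, projN, ih, hs]
  rw [proj, proj, dist_smul, this]

/-- Either `y` lies in the image of the orbit of `x`, or the projection of `y` is that of a
closer point. -/
theorem proj_cases {x : X} {y : Y} (hy : ∃ h : H, y = h • T.f x) :
    (∃ γ : Γ, T.proj x y = γ • x ∧ T.f (γ • x) = y) ∨
      ∃ i, ∃ b ∈ T.B i, T.proj x y = T.proj x (b • y) ∧ T.dist x (b • y) < T.dist x y := by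
  have hl := T.lev_dist hy
  rcases hd : T.dist x y with _ | n
  · left
    rw [hd] at hl
    rw [proj, hd]
    exact T.base_spec hl
  · right
    rw [hd] at hl
    have hl' := firstOf_mem (S := {l : T.Letter | T.lev n x ((l.2 : H) • y)}) hl
    set l := firstOf {l : T.Letter | T.lev n x ((l.2 : H) • y)} with hldef
    have hle : T.dist x ((l.2 : H) • y) ≤ n := T.dist_le hl'
    have heq : T.dist x ((l.2 : H) • y) = n := by
      refine le_antisymm hle ?_
      obtain ⟨h, rfl⟩ := hy
      have h1 := T.lev_dist (x := x) (y := (l.2 : H) • h • T.f x) ⟨l.2 * h, by rw [mul_smul]⟩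
      have h2 : T.lev (T.dist x ((l.2 : H) • h • T.f x) + 1) x (h • T.f x) := ⟨l, h1⟩
      have := T.dist_le h2
      omega
    refine ⟨l.1, l.2, l.2.2, ?_, by omega⟩
    rw [proj, proj, hd, heq, projN]

theorem proj_induction {x : X} {P : Y → Prop}
    (h0 : ∀ γ : Γ, T.proj x (T.f (γ • x)) = γ • x → P (T.f (γ • x)))
    (h1 : ∀ y, ∀ i, ∀ b ∈ T.B i, (∃ h : H, y = h • T.f x) → T.proj x y = T.proj x (b • y) →
      P (b • y) → P y) {y : Y} (hy : ∃ h : H, y = h • T.f x) : P y := by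
  induction hn : T.dist x y using Nat.strong_induction_on generalizing y with
  | _ n ih =>
  rcases T.proj_cases hy with ⟨γ, h2, rfl⟩ | ⟨i, b, hb, h2, h3⟩
  · exact h0 γ h2
  · refine h1 y i b hb hy h2 (ih _ (hn ▸ h3) ?_ rfl)
    obtain ⟨h, rfl⟩ := hy
    exact ⟨b * h, by rw [mul_smul]⟩

theorem proj_mem {x : X} {y : Y} (hy : ∃ h : H, y = h • T.f x) : ∃ γ : Γ, T.proj x y = γ • x := by
  refine T.proj_induction (P := fun y => ∃ γ : Γ, T.proj x y = γ • x) ?_ ?_ hy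
  · exact fun γ h => ⟨γ, h⟩
  · intro y i b hb hy h1 h2
    rwa [h1]

theorem f_proj_f (γ : Γ) (x : X) : T.f (T.proj x (T.f (γ • x))) = T.f (γ • x) := by
  have h0 : T.dist x (T.f (γ • x)) = 0 := Nat.le_zero.mp (T.dist_le ⟨γ, rfl⟩)
  obtain ⟨δ, h1, h2⟩ := T.base_spec (x := x) (y := T.f (γ • x)) ⟨γ, rfl⟩
  rw [proj, h0, projN, h1, h2]

theorem proj_f_proj {x : X} {y : Y} (hy : ∃ h : H, y = h • T.f x) :
    T.proj x (T.f (T.proj x y)) = T.proj x y := by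
  refine T.proj_induction (P := fun y => T.proj x (T.f (T.proj x y)) = T.proj x y) ?_ ?_ hy
  · intro γ h
    rw [h, h]
  · intro y i b hb hy h1 h2
    rw [h1, h2]

end

/-- The gate map onto the coset `B i • y₀`. -/
theorem exists_gate {x : X} {y₀ : Y} (hy₀ : ∃ h : H, y₀ = h • T.f x) (i : ι) :
    ∃ r : Y → Y, (∀ b ∈ T.B i, r (b • y₀) = b • y₀) ∧
      ∀ j, ∀ b ∈ T.B j, ∀ h : H, (j = i → ¬ ∃ c ∈ T.B i, h • y₀ = c • y₀) →
        r (b • h • y₀) = r (h • y₀) := by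
  classical
  obtain ⟨ρ, h1, h2, -⟩ := T.freeProduct.exists_retraction i
  have hfree : ∀ h h' : H, h • y₀ = h' • y₀ → h = h' := by
    obtain ⟨k, rfl⟩ := hy₀
    intro h h' hh
    have : (k⁻¹ * h'⁻¹ * h * k) • T.f x = T.f x := by
      simp only [mul_smul, hh, inv_smul_smul]
    have := T.free _ _ this
    have h3 : h'⁻¹ * h = 1 := by
      calc h'⁻¹ * h = k * (k⁻¹ * h'⁻¹ * h * k) * k⁻¹ := by group
        _ = 1 := by rw [this]; group
    exact (inv_mul_eq_one.mp h3).symm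
  have hr : ∃ r : Y → Y, ∀ h : H, r (h • y₀) = ρ h • y₀ := by
    refine ⟨fun y => if hy : ∃ h : H, y = h • y₀ then ρ hy.choose • y₀ else y, fun h => ?_⟩
    have hy : ∃ h' : H, h • y₀ = h' • y₀ := ⟨h, rfl⟩
    beta_reduce
    rw [dif_pos hy, ← hfree _ _ hy.choose_spec]
  obtain ⟨r, hr⟩ := hr
  refine ⟨r, fun b hb => by rw [hr, h1 b hb], fun j b hb h hh => ?_⟩
  rw [← mul_smul, hr, hr, h2 j b hb h]
  by_cases hj : j = i
  · right
    intro hm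
    exact hh hj ⟨h, hm, rfl⟩
  · exact Or.inl hj

section Measurability
variable [Countable H] [Countable ι] [Countable Γ] [MeasurableConstSMul Γ X]
  [MeasurableConstSMul H Y] [StandardBorelSpace Y]

theorem measurableSet_lev (n : ℕ) : MeasurableSet {p : X × Y | T.lev n p.1 p.2} := by
  induction n with
  | zero =>
    have : {p : X × Y | T.lev 0 p.1 p.2} = ⋃ γ : Γ, {p | T.f (γ • p.1) = p.2} := by
      ext p; simp [lev]
    rw [this]
    exact .iUnion fun γ => measurableSet_eq_fun
      (T.measurable_f.comp ((measurable_const_smul γ).comp measurable_fst)) measurable_snd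
  | succ n ih =>
    have : {p : X × Y | T.lev (n + 1) p.1 p.2} =
        ⋃ l : T.Letter, (fun p : X × Y => (p.1, (l.2 : H) • p.2)) ⁻¹'
          {p : X × Y | T.lev n p.1 p.2} := by
      ext p; simp [lev]
    rw [this]
    exact .iUnion fun l => (measurable_fst.prodMk
      ((measurable_const_smul (l.2 : H)).comp measurable_snd)) ih

variable [Nonempty ι]

theorem measurable_projN (n : ℕ) : Measurable fun p : X × Y => T.projN n p.1 p.2 := by
  induction n with
  | zero =>
    refine measurable_nat_apply (F := fun n (p : X × Y) => T.s n p.2) (measurable_sInf_nat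
      (P := fun (p : X × Y) n => ∃ γ : Γ, T.f (γ • p.1) = p.2 ∧ T.e (γ • p.1) = n) fun n => ?_)
      fun n => (T.measurable_s n).comp measurable_snd
    have : {p : X × Y | ∃ γ : Γ, T.f (γ • p.1) = p.2 ∧ T.e (γ • p.1) = n} =
        ⋃ γ : Γ, {p | T.f (γ • p.1) = p.2} ∩ (fun p => T.e (γ • p.1)) ⁻¹' {n} := by
      ext p; simp
    rw [this]
    exact .iUnion fun γ => (measurableSet_eq_fun
      (T.measurable_f.comp ((measurable_const_smul γ).comp measurable_fst)) measurable_snd).inter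
        ((T.measurable_e.comp ((measurable_const_smul γ).comp measurable_fst)) (.singleton n))
  | succ n ih =>
    exact measurable_of_firstOf (P := fun (p : X × Y) (l : T.Letter) => T.lev n p.1 ((l.2 : H) • p.2))
      (F := fun p l => T.projN n p.1 ((l.2 : H) • p.2))
      (fun l => (measurable_fst.prodMk
        ((measurable_const_smul (l.2 : H)).comp measurable_snd)) (T.measurableSet_lev n))
      (fun l => ih.comp (measurable_fst.prodMk
        ((measurable_const_smul (l.2 : H)).comp measurable_snd)))

theorem measurable_proj : Measurable fun p : X × Y => T.proj p.1 p.2 :=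
  measurable_nat_apply (F := fun n (p : X × Y) => T.projN n p.1 p.2)
    (measurable_sInf_nat fun n => T.measurableSet_lev n) T.measurable_projN

end Measurability

end TreeMap

namespace TreeMap

variable {Γ H X Y ι : Type} [Group Γ] [Group H] [MulAction Γ X] [MulAction H Y]
  [MeasurableSpace X] [MeasurableSpace Y] (T : TreeMap Γ H X Y ι)
  [Countable H] [Countable ι] [Nonempty ι]

/-- The labels of `z` as a member of the hyperedge obtained by projecting the coset `B i • y`. -/
def Lab (i : ι) (z : X) (y : Y) : Set H :=
  {h | T.proj z (h • T.f z) = z ∧ ∃ b ∈ T.B i, h • T.f z = b • y}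

/-- The preferred label of the hyperedge of `B i • y`. -/
noncomputable def mlab (i : ι) (x : X) (y : Y) : H := firstOf {h | ∃ γ : Γ, h ∈ T.Lab i (γ • x) y}

theorem Lab_smul (i : ι) (z : X) (y : Y) {b : H} (hb : b ∈ T.B i) :
    T.Lab i z (b • y) = T.Lab i z y := by
  ext h
  constructor
  · rintro ⟨h1, c, hc, h2⟩
    exact ⟨h1, c * b, mul_mem hc hb, by rw [h2, mul_smul]⟩
  · rintro ⟨h1, c, hc, h2⟩
    exact ⟨h1, c * b⁻¹, mul_mem hc (inv_mem hb), by rw [h2, mul_smul, inv_smul_smul]⟩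

theorem mlab_smul_right (i : ι) (x : X) (y : Y) {b : H} (hb : b ∈ T.B i) :
    T.mlab i x (b • y) = T.mlab i x y := by
  simp only [mlab, T.Lab_smul i _ y hb]

theorem mlab_smul_left (i : ι) (x : X) (y : Y) (γ : Γ) :
    T.mlab i (γ • x) y = T.mlab i x y := by
  have : {h | ∃ δ : Γ, h ∈ T.Lab i (δ • γ • x) y} = {h | ∃ δ : Γ, h ∈ T.Lab i (δ • x) y} := by
    ext n
    constructor
    · rintro ⟨δ, h⟩
      exact ⟨δ * γ, by rwa [mul_smul]⟩
    · rintro ⟨δ, h⟩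
      exact ⟨δ * γ⁻¹, by rwa [mul_smul, inv_smul_smul]⟩
  rw [mlab, mlab, this]

theorem exists_mlab_mem {i : ι} {z : X} {y : Y} (h : (T.Lab i z y).Nonempty) :
    ∃ γ : Γ, T.mlab i z y ∈ T.Lab i (γ • z) y := by
  obtain ⟨k, hk⟩ := h
  exact firstOf_mem (S := {h | ∃ γ : Γ, h ∈ T.Lab i (γ • z) y}) ⟨k, 1, by rwa [one_smul]⟩

theorem self_mem_Lab {i : ι} {z : X} {h : H} (hz : T.proj z (h • T.f z) = z) :
    h ∈ T.Lab i z (h • T.f z) :=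
  ⟨hz, 1, one_mem _, by rw [one_smul]⟩

theorem proj_f_of_Lab {i : ι} {z : X} {y : Y} (h : (T.Lab i z y).Nonempty) :
    T.proj z (T.f z) = z := by
  obtain ⟨k, hk, -⟩ := h
  have := T.proj_f_proj (x := z) (y := k • T.f z) ⟨k, rfl⟩
  rwa [hk] at this

theorem mlab_eq_of_mem {i : ι} {z : X} {y : Y} {h : H} (hh : h ∈ T.Lab i z y) :
    T.mlab i z (h • T.f z) = T.mlab i z y ∧ T.Lab i z (h • T.f z) = T.Lab i z y := by
  obtain ⟨-, b, hb, h2⟩ := hh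
  rw [h2]
  exact ⟨T.mlab_smul_right i z y hb, T.Lab_smul i z y hb⟩

/-- The retraction of the orbit of `x` onto the hyperedge of `B i • y₀`. -/
theorem exists_ret {x : X} {y₀ : Y} (hy₀ : ∃ h : H, y₀ = h • T.f x) (i : ι) :
    ∃ R : X → X,
      (∀ γ : Γ, (T.Lab i (γ • x) y₀).Nonempty → R (γ • x) = γ • x) ∧
      (∀ j y₁, ∀ γ γ' : Γ, (T.Lab j (γ • x) y₁).Nonempty → (T.Lab j (γ' • x) y₁).Nonempty →
        (j = i → ¬ ∃ c ∈ T.B i, y₁ = c • y₀) → R (γ • x) = R (γ' • x)) ∧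
      (∀ γ : Γ, R (T.proj x (T.f (γ • x))) = R (γ • x)) := by
  obtain ⟨r, hr1, hr2⟩ := T.exists_gate hy₀ i
  obtain ⟨k₀, hk₀⟩ := hy₀
  have horb : ∀ h : H, ∃ k : H, h • T.f x = k • y₀ := fun h =>
    ⟨h * k₀⁻¹, by rw [hk₀, mul_smul, inv_smul_smul]⟩
  have horb' : ∀ γ : Γ, ∀ h : H, ∃ k : H, h • T.f (γ • x) = k • T.f x := by
    intro γ h
    obtain ⟨k, hk⟩ := T.f_mem γ x
    exact ⟨h * k, by rw [hk, mul_smul]⟩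
  have key : ∀ y, (∃ h : H, y = h • T.f x) →
      T.proj x (r (T.f (T.proj x y))) = T.proj x (r y) := by
    intro y hy
    refine T.proj_induction
      (P := fun y => T.proj x (r (T.f (T.proj x y))) = T.proj x (r y)) ?_ ?_ hy
    · intro γ _
      rw [T.f_proj_f]
    · intro y j b hb hy h1 h2
      obtain ⟨h, rfl⟩ := hy
      obtain ⟨k, hk⟩ := horb h
      rw [hk] at h1 h2 ⊢
      by_cases hc : j = i ∧ ∃ c ∈ T.B i, k • y₀ = c • y₀
      · obtain ⟨rfl, c, hc, hkc⟩ := hc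
        have h3 : r (k • y₀) = k • y₀ := by rw [hkc, hr1 c hc]
        have h4 : r (b • k • y₀) = b • k • y₀ := by
          rw [hkc, ← mul_smul, hr1 _ (mul_mem hb hc)]
        rw [h1, h2, h3, h4, ← h1]
      · rw [h1, h2, hr2 j b hb k (not_and.mp hc)]
  have keyL : ∀ j y₁, ∀ γ : Γ, ∀ h ∈ T.Lab j (γ • x) y₁,
      T.proj x (r (T.f (γ • x))) = T.proj x (r (h • T.f (γ • x))) := by
    intro j y₁ γ h hh
    have h1 := hh.1
    rw [T.proj_smul] at h1
    rw [← key _ (horb' γ h), h1]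
  refine ⟨fun u => T.proj x (r (T.f u)), ?_, ?_, ?_⟩
  · rintro γ ⟨h, hh⟩
    beta_reduce
    rw [keyL i y₀ γ h hh]
    obtain ⟨h1, b, hb, h2⟩ := hh
    rw [h2, hr1 b hb, ← h2]
    rwa [T.proj_smul] at h1
  · have hbase : ∀ j y₁, ∀ γ : Γ, (T.Lab j (γ • x) y₁).Nonempty →
        (j = i → ¬ ∃ c ∈ T.B i, y₁ = c • y₀) →
        T.proj x (r (T.f (γ • x))) = T.proj x (r y₁) := by
      rintro j y₁ γ ⟨h, hh⟩ hne
      rw [keyL j y₁ γ h hh]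
      obtain ⟨-, b, hb, h2⟩ := hh
      obtain ⟨k, hk⟩ : ∃ k : H, y₁ = k • y₀ := by
        obtain ⟨k, hk⟩ := horb' γ h
        obtain ⟨k', hk'⟩ := horb k
        refine ⟨b⁻¹ * k', ?_⟩
        rw [mul_smul, ← hk', ← hk, h2, inv_smul_smul]
      rw [h2, hk, hr2 j b hb k]
      intro hj
      rw [← hk]
      exact hne hj
    intro j y₁ γ γ' h h' hne
    exact (hbase j y₁ γ h hne).trans (hbase j y₁ γ' h' hne).symm
  · intro γ
    beta_reduce
    rw [T.f_proj_f]

/-- The point `z` carries the preferred label `h` of the hyperedge of `B i • h • f z`. -/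
def Central (i : ι) (h : H) (z : X) : Prop :=
  T.proj z (h • T.f z) = z ∧ T.mlab i z (h • T.f z) = h

/-- The relation gathering the points of a hyperedge which carry the preferred label `h`. -/
def Clique (i : ι) (h : H) (z z' : X) : Prop :=
  z = z' ∨ T.Central i h z ∧ T.Central i h z' ∧ (∃ γ : Γ, γ • z = z') ∧
    ∃ b ∈ T.B i, h • T.f z' = b • h • T.f z

section Leaf
variable [Countable Γ]

/-- A point in the orbit of `z` carrying the preferred label of the hyperedge of `B i • y`. -/
noncomputable def att (i : ι) (z : X) (y : Y) : X :=
  firstOf {γ : Γ | T.mlab i z y ∈ T.Lab i (γ • z) y} • z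

/-- The points to be attached as leaves: those which differ from the preferred point in their
fibre, and the members of a hyperedge which do not carry its preferred label. -/
def leafDom : Option (ι × H) → X → Prop
  | none, z => T.proj z (T.f z) ≠ z
  | some (i, h), z => T.proj z (h • T.f z) = z ∧ firstOf (T.Lab i z (h • T.f z)) = h ∧
      T.mlab i z (h • T.f z) ∉ T.Lab i z (h • T.f z)

/-- The points to which leaves are attached. -/
noncomputable def leafTgt : Option (ι × H) → X → X
  | none, z => T.proj z (T.f z)
  | some (i, h), z => T.att i z (h • T.f z)

theorem att_smul (i : ι) (z : X) (y : Y) {b : H} (hb : b ∈ T.B i) :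
    T.att i z (b • y) = T.att i z y := by
  simp only [att, T.mlab_smul_right i z y hb, T.Lab_smul i _ y hb]

theorem att_spec {i : ι} {z : X} {y : Y} (h : (T.Lab i z y).Nonempty) :
    ∃ γ : Γ, T.att i z y = γ • z ∧ T.mlab i z y ∈ T.Lab i (γ • z) y :=
  ⟨_, rfl, firstOf_mem (S := {γ : Γ | T.mlab i z y ∈ T.Lab i (γ • z) y}) (T.exists_mlab_mem h)⟩

theorem leafTgt_mem {k : Option (ι × H)} {z : X} : ∃ γ : Γ, γ • z = T.leafTgt k z := by
  rcases k with _ | ⟨i, h⟩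
  · obtain ⟨γ, hγ⟩ := T.proj_mem (x := z) (y := T.f z) ⟨1, by rw [one_smul]⟩
    exact ⟨γ, hγ.symm⟩
  · exact ⟨_, rfl⟩

theorem leafTgt_ne {k : Option (ι × H)} {z : X} (hk : T.leafDom k z) : T.leafTgt k z ≠ z := by
  rcases k with _ | ⟨i, h⟩
  · exact hk
  · obtain ⟨γ, h1, h2⟩ := T.att_spec (i := i) ⟨h, T.self_mem_Lab hk.1⟩
    intro heq
    rw [← h1] at h2
    change T.att i z (h • T.f z) = z at heq
    rw [heq] at h2
    exact hk.2.2 h2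

/-- Cliques and leaves other than the given clique are collapsed by a retraction onto it. -/
theorem exists_clique_ret (i : ι) (h : H) (x : X) : ∃ r : X → X,
    (∀ u, T.Clique i h x u → r u = u) ∧
    (∀ j h' u u', T.Clique j h' u u' → (j = i → h' = h → ¬ T.Clique i h x u) → r u = r u') ∧
    (∀ k u, T.leafDom k u → r u = r (T.leafTgt k u)) := by
  classical
  by_cases hx : T.Central i h x
  swap
  · refine ⟨fun _ => x, ?_, fun _ _ _ _ _ _ => rfl, fun _ _ _ => rfl⟩
    rintro u (rfl | ⟨h1, -⟩)
    · rfl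
    · exact absurd h1 hx
  set y := h • T.f x with hy
  obtain ⟨R, hR1, hR2, hR3⟩ := T.exists_ret (x := x) (y₀ := y) ⟨h, rfl⟩ i
  let r : X → X := fun u => if ∃ γ : Γ, γ • x = u then
    (if h ∈ T.Lab i (R u) y then R u else T.att i (R u) y) else x
  have hrin : ∀ γ : Γ, r (γ • x) =
      if h ∈ T.Lab i (R (γ • x)) y then R (γ • x) else T.att i (R (γ • x)) y :=
    fun γ => if_pos ⟨γ, rfl⟩
  have hrout : ∀ u, (¬ ∃ γ : Γ, γ • x = u) → r u = x := fun u hu => if_neg hu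
  have hrL : ∀ γ : Γ, h ∈ T.Lab i (γ • x) y → r (γ • x) = γ • x := by
    intro γ hγ
    rw [hrin, hR1 γ ⟨h, hγ⟩, if_pos hγ]
  have hreq : ∀ γ γ' : Γ, R (γ • x) = R (γ' • x) → r (γ • x) = r (γ' • x) := by
    intro γ γ' hγ
    rw [hrin, hrin, hγ]
  have hm : ∀ γ : Γ, T.mlab i (γ • x) y = h := fun γ => by rw [T.mlab_smul_left]; exact hx.2
  refine ⟨r, ?_, ?_, ?_⟩
  · rintro u (rfl | ⟨-, h2, ⟨γ, rfl⟩, b, hb, h3⟩)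
    · have := hrL 1 (by rw [one_smul]; exact T.self_mem_Lab hx.1)
      rwa [one_smul] at this
    · exact hrL γ ⟨h2.1, b, hb, h3⟩
  · rintro j h' u u' (rfl | ⟨h1, h2, ⟨δ, rfl⟩, b, hb, h3⟩) hne
    · rfl
    by_cases hu : ∃ γ : Γ, γ • x = u
    swap
    · rw [hrout u hu, hrout]
      rintro ⟨γ, hγ⟩
      exact hu ⟨δ⁻¹ * γ, by rw [mul_smul, hγ, inv_smul_smul]⟩
    obtain ⟨γ, rfl⟩ := hu
    rw [← mul_smul] at h2 h3 ⊢
    by_cases hc : j = i ∧ ∃ c ∈ T.B i, h' • T.f (γ • x) = c • y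
    · obtain ⟨rfl, c, hc, h4⟩ := hc
      exfalso
      have hh : h' = h := by
        rw [← h1.2, h4, T.mlab_smul_right _ _ _ hc, hm]
      subst hh
      exact hne rfl rfl (Or.inr ⟨hx, h1, ⟨γ, rfl⟩, c, hc, h4⟩)
    · refine hreq _ _ (hR2 j (h' • T.f (γ • x)) γ (δ * γ) ⟨h', T.self_mem_Lab h1.1⟩
        ⟨h', h2.1, b, hb, h3⟩ ?_)
      exact not_and.mp hc
  · intro k u hk
    by_cases hu : ∃ γ : Γ, γ • x = u
    swap
    · rw [hrout u hu, hrout]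
      rintro ⟨γ, hγ⟩
      obtain ⟨δ, hδ⟩ := T.leafTgt_mem (k := k) (z := u)
      exact hu ⟨δ⁻¹ * γ, by rw [mul_smul, hγ, ← hδ, inv_smul_smul]⟩
    obtain ⟨γ, rfl⟩ := hu
    rcases k with _ | ⟨j, h'⟩
    · obtain ⟨δ, hδ⟩ := T.leafTgt_mem (k := none) (z := γ • x)
      rw [← hδ, ← mul_smul]
      refine (hreq _ _ ?_).symm
      rw [mul_smul, hδ]
      change R (T.proj (γ • x) _) = _
      rw [T.proj_smul, hR3]
    · have hL : h' ∈ T.Lab j (γ • x) (h' • T.f (γ • x)) := T.self_mem_Lab hk.1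
      obtain ⟨δ, hδ, hδm⟩ := T.att_spec ⟨h', hL⟩
      change r (γ • x) = r (T.att j (γ • x) (h' • T.f (γ • x)))
      by_cases hc : j = i ∧ ∃ c ∈ T.B i, h' • T.f (γ • x) = c • y
      · obtain ⟨rfl, c, hc, h4⟩ := hc
        have hn := hk.2.2
        rw [h4, T.mlab_smul_right _ _ _ hc, T.Lab_smul _ _ _ hc, hm] at hn hδm
        rw [h4, T.Lab_smul _ _ _ hc] at hL
        rw [hrin, hR1 γ ⟨h', hL⟩, if_neg hn, hδ, ← mul_smul, hrL (δ * γ) (by rwa [mul_smul]),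
          mul_smul, ← hδ, h4, T.att_smul _ _ _ hc]
      · rw [hδ, ← mul_smul]
        refine hreq _ _ (hR2 j (h' • T.f (γ • x)) γ (δ * γ) ⟨h', hL⟩
          ⟨_, by rw [mul_smul]; exact hδm⟩ ?_)
        exact not_and.mp hc

/-- A leaf can be separated from the point it is attached to. -/
theorem exists_leaf_side {k : Option (ι × H)} {z : X} (hz : T.leafDom k z) : ∃ side : X → Prop,
    side z ∧ ¬ side (T.leafTgt k z) ∧
    (∀ j h u u', T.Clique j h u u' → (side u ↔ side u')) ∧
    (∀ k' u, T.leafDom k' u → ¬ (k' = k ∧ u = z) → (side u ↔ side (T.leafTgt k' u))) := by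
  rcases k with _ | ⟨i, h⟩
  · have hfix : ∀ (j : ι) (y : Y) (u : X), (T.Lab j u y).Nonempty → u ≠ z := by
      rintro j y u hu rfl
      exact hz (T.proj_f_of_Lab hu)
    have hatt : ∀ (j : ι) (y : Y) (u : X), (T.Lab j u y).Nonempty → T.att j u y ≠ z := by
      intro j y u hu
      obtain ⟨δ, h1, h2⟩ := T.att_spec hu
      rw [h1]
      exact hfix j y _ ⟨_, h2⟩
    refine ⟨fun u => u = z, rfl, hz, ?_, ?_⟩
    · rintro j h u u' (rfl | ⟨h1, h2, -⟩)
      · rfl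
      · exact iff_of_false (hfix j _ u ⟨h, T.self_mem_Lab h1.1⟩)
          (hfix j _ u' ⟨h, T.self_mem_Lab h2.1⟩)
    · rintro (_ | ⟨j, h⟩) u hu hne
      · refine iff_of_false (fun h => hne ⟨rfl, h⟩) ?_
        rintro rfl
        obtain ⟨δ, hδ⟩ := T.leafTgt_mem (k := none) (z := u)
        refine hz ?_
        rw [← hδ, T.proj_smul, hδ]
        exact T.proj_f_proj ⟨1, by rw [one_smul]⟩
      · exact iff_of_false (hfix j _ u ⟨h, T.self_mem_Lab hu.1⟩)
          (hatt j _ u ⟨h, T.self_mem_Lab hu.1⟩)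
  · set y := h • T.f z with hy
    obtain ⟨R, hR1, hR2, hR3⟩ := T.exists_ret (x := z) (y₀ := y) ⟨h, rfl⟩ i
    have hL : h ∈ T.Lab i z y := T.self_mem_Lab hz.1
    let side : X → Prop := fun u => (∃ γ : Γ, γ • z = u) ∧ R u = z
    have hin : ∀ γ : Γ, side (γ • z) ↔ R (γ • z) = z := fun γ => ⟨fun h => h.2, fun h => ⟨⟨γ, rfl⟩, h⟩⟩
    have hm : ∀ γ : Γ, T.mlab i (γ • z) y = T.mlab i z y := fun γ => T.mlab_smul_left _ _ _ _
    have hcen : ∀ γ : Γ, T.mlab i z y ∈ T.Lab i (γ • z) y → ¬ side (γ • z) := by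
      intro γ hγ hs
      have h1 := hR1 γ ⟨_, hγ⟩
      rw [hs.2] at h1
      rw [← h1] at hγ
      exact hz.2.2 hγ
    refine ⟨side, ?_, ?_, ?_, ?_⟩
    · have := (hin 1).2 (by rw [hR1 1 (by rw [one_smul]; exact ⟨h, hL⟩), one_smul])
      rwa [one_smul] at this
    · obtain ⟨δ, hδ, hδm⟩ := T.att_spec ⟨h, hL⟩
      change ¬ side (T.att i z y)
      rw [hδ]
      exact hcen δ hδm
    · rintro j h' u u' (rfl | ⟨h1, h2, ⟨δ, rfl⟩, b, hb, h3⟩)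
      · rfl
      by_cases hu : ∃ γ : Γ, γ • z = u
      swap
      · refine iff_of_false (fun h => hu h.1) ?_
        rintro ⟨⟨γ, hγ⟩, -⟩
        exact hu ⟨δ⁻¹ * γ, by rw [mul_smul, hγ, inv_smul_smul]⟩
      obtain ⟨γ, rfl⟩ := hu
      rw [← mul_smul] at h2 h3 ⊢
      by_cases hc : j = i ∧ ∃ c ∈ T.B i, h' • T.f (γ • z) = c • y
      · obtain ⟨rfl, c, hc, h4⟩ := hc
        have hh : h' = T.mlab j z y := by
          rw [← h1.2, h4, T.mlab_smul_right _ _ _ hc, hm]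
        refine iff_of_false (hcen _ ?_) (hcen _ ?_)
        · rw [← hh]
          exact ⟨h1.1, c, hc, h4⟩
        · rw [← hh]
          exact ⟨h2.1, b * c, mul_mem hb hc, by rw [h3, h4, mul_smul]⟩
      · rw [hin, hin, hR2 j (h' • T.f (γ • z)) γ (δ * γ) ⟨h', T.self_mem_Lab h1.1⟩
          ⟨h', h2.1, b, hb, h3⟩ (not_and.mp hc)]
    · intro k u hk hne
      by_cases hu : ∃ γ : Γ, γ • z = u
      swap
      · refine iff_of_false (fun h => hu h.1) ?_
        rintro ⟨⟨γ, hγ⟩, -⟩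
        obtain ⟨δ, hδ⟩ := T.leafTgt_mem (k := k) (z := u)
        exact hu ⟨δ⁻¹ * γ, by rw [mul_smul, hγ, ← hδ, inv_smul_smul]⟩
      obtain ⟨γ, rfl⟩ := hu
      rcases k with _ | ⟨j, h'⟩
      · obtain ⟨δ, hδ⟩ := T.leafTgt_mem (k := none) (z := γ • z)
        have hRR : R ((δ * γ) • z) = R (γ • z) := by
          rw [mul_smul, hδ]
          change R (T.proj (γ • z) _) = _
          rw [T.proj_smul, hR3]
        rw [← hδ, ← mul_smul, hin, hin, hRR]
      · have hL' : h' ∈ T.Lab j (γ • z) (h' • T.f (γ • z)) := T.self_mem_Lab hk.1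
        obtain ⟨δ, hδ, hδm⟩ := T.att_spec ⟨h', hL'⟩
        change side (γ • z) ↔ side (T.att j (γ • z) (h' • T.f (γ • z)))
        rw [hδ]
        by_cases hc : j = i ∧ ∃ c ∈ T.B i, h' • T.f (γ • z) = c • y
        · obtain ⟨rfl, c, hc, h4⟩ := hc
          rw [h4, T.mlab_smul_right _ _ _ hc, T.Lab_smul _ _ _ hc, hm] at hδm
          refine iff_of_false ?_ (by rw [← mul_smul] at hδm ⊢; exact hcen _ hδm)
          intro hs
          have hs2 := hs.2
          rw [h4, T.Lab_smul _ _ _ hc] at hL'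
          rw [hR1 γ ⟨h', hL'⟩] at hs2
          refine hne ⟨?_, hs2⟩
          have h5 := hk.2.1
          rw [h4, T.Lab_smul _ _ _ hc, hs2] at h5
          rw [← h5]
          congr 2
          exact hz.2.1
        · rw [← mul_smul, hin, hin, hR2 j (h' • T.f (γ • z)) γ (δ * γ) ⟨h', hL'⟩
            ⟨_, by rw [mul_smul]; exact hδm⟩ (not_and.mp hc)]

/-- Cliques and leaves generate the orbit equivalence relation. -/
theorem eqvGen_of_mem_orbit (γ : Γ) (x : X) {r : X → X → Prop}
    (hr1 : ∀ i h u u', T.Clique i h u u' → Relation.EqvGen r u u')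
    (hr2 : ∀ k u, T.leafDom k u → Relation.EqvGen r u (T.leafTgt k u)) :
    Relation.EqvGen r x (γ • x) := by
  have htau : ∀ u, Relation.EqvGen r u (T.proj u (T.f u)) := by
    intro u
    by_cases hu : T.proj u (T.f u) = u
    · rw [hu]
      exact .refl _
    · exact hr2 none u hu
  have hcen : ∀ i z y, (T.Lab i z y).Nonempty → ∃ δ : Γ, T.mlab i z y ∈ T.Lab i (δ • z) y ∧
      Relation.EqvGen r z (δ • z) := by
    intro i z y hL
    by_cases hm : T.mlab i z y ∈ T.Lab i z y
    · exact ⟨1, by rwa [one_smul], by rw [one_smul]; exact .refl _⟩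
    · obtain ⟨δ, hδ, hδm⟩ := T.att_spec hL
      refine ⟨δ, hδm, ?_⟩
      have hf := firstOf_mem hL
      obtain ⟨h1, h2⟩ := T.mlab_eq_of_mem hf
      have := hr2 (some (i, firstOf (T.Lab i z y))) z ⟨hf.1, by rw [h2], by rwa [h1, h2]⟩
      have h3 : T.leafTgt (some (i, firstOf (T.Lab i z y))) z = T.att i z y := by
        change T.att i z (_ • T.f z) = _
        obtain ⟨-, b, hb, h4⟩ := hf
        rw [h4, T.att_smul _ _ _ hb]
      rwa [h3, hδ] at this
  have hmem : ∀ i z (δ : Γ) y, (T.Lab i z y).Nonempty → (T.Lab i (δ • z) y).Nonempty →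
      Relation.EqvGen r z (δ • z) := by
    intro i z δ y h1 h2
    obtain ⟨ε, h3, h4⟩ := hcen i z y h1
    obtain ⟨ε', h5, h6⟩ := hcen i _ y h2
    refine (h4.trans _ _ _ ?_).trans _ _ _ (h6.symm _ _)
    rw [T.mlab_smul_left] at h5
    refine hr1 i (T.mlab i z y) _ _ (Or.inr ⟨?_, ?_, ⟨ε' * δ * ε⁻¹, by simp [mul_smul]⟩, ?_⟩)
    · refine ⟨h3.1, ?_⟩
      rw [(T.mlab_eq_of_mem h3).1, T.mlab_smul_left]
    · refine ⟨h5.1, ?_⟩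
      rw [(T.mlab_eq_of_mem h5).1, T.mlab_smul_left, T.mlab_smul_left]
    · obtain ⟨-, b, hb, h7⟩ := h3
      obtain ⟨-, b', hb', h8⟩ := h5
      exact ⟨b' * b⁻¹, mul_mem hb' (inv_mem hb), by rw [h7, h8, mul_smul, inv_smul_smul]⟩
  have hproj : ∀ h : H, Relation.EqvGen r (T.proj x (T.f x)) (T.proj x (h • T.f x)) := by
    refine T.freeProduct.induction_left ?_ ?_
    · rw [one_smul]
      exact .refl _
    · intro i b hb h ih
      refine ih.trans _ _ _ ?_
      have hL : ∀ c ∈ T.B i, (T.Lab i (T.proj x (c • h • T.f x)) (h • T.f x)).Nonempty := by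
        intro c hc
        obtain ⟨δ, hδ⟩ := T.proj_mem (x := x) (y := c • h • T.f x) ⟨c * h, by rw [mul_smul]⟩
        obtain ⟨k, hk⟩ := T.f_mem δ x
        have hkey : (c * h * k⁻¹) • T.f (δ • x) = c • h • T.f x := by
          rw [hk, mul_smul, inv_smul_smul, mul_smul]
        rw [hδ]
        refine ⟨c * h * k⁻¹, ?_, c, hc, hkey⟩
        rw [hkey, T.proj_smul, hδ]
      have h1 := hL 1 (one_mem _)
      have h2 := hL b hb
      obtain ⟨δ, hδ⟩ := T.proj_mem (x := x) (y := h • T.f x) ⟨h, rfl⟩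
      obtain ⟨δ', hδ'⟩ := T.proj_mem (x := x) (y := b • h • T.f x) ⟨b * h, by rw [mul_smul]⟩
      rw [one_smul, hδ] at h1
      rw [hδ'] at h2
      have h3 : δ' • x = (δ' * δ⁻¹) • δ • x := by simp [mul_smul]
      rw [mul_smul, hδ, hδ', h3]
      refine hmem i _ _ (h • T.f x) h1 ?_
      rwa [← h3]
  obtain ⟨h, hh⟩ := T.f_mem γ x
  have h1 := hproj h
  rw [← hh] at h1
  have h2 := htau (γ • x)
  rw [T.proj_smul] at h2
  exact ((htau x).trans _ _ _ h1).trans _ _ _ (h2.symm _ _)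

end Leaf

end TreeMap

/-- A Borel set meeting each orbit of an essentially free p.m.p. action of an infinite group in at
most one point is null. -/
theorem PMPAction.measure_eq_zero_of_wandering {Γ X : Type} [Group Γ] [Countable Γ] [Infinite Γ]
    [MeasurableSpace X] {μ : Measure X} [IsProbabilityMeasure μ] (α : PMPAction Γ X μ)
    (hα : α.IsFree) {W : Set X} (hW : MeasurableSet W)
    (h : ∀ x ∈ W, ∀ γ, α.act γ x ∈ W → α.act γ x = x) : μ W = 0 := by
  by_contra hne
  have hdisj : Pairwise (Function.onFun (AEDisjoint μ) fun γ => α.act γ ⁻¹' W) := by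
    intro γ δ hγδ
    refine measure_mono_null ?_ hα
    rintro x ⟨hx1, hx2⟩ hx
    have h1 : α.act (δ * γ⁻¹) (α.act γ x) = α.act δ x := by
      rw [← α.act_mul, inv_mul_cancel_right]
    have h2 := h _ hx1 (δ * γ⁻¹) (by rw [h1]; exact hx2)
    rw [h1] at h2
    have h3 : α.act (γ⁻¹ * δ) x = x := by
      rw [α.act_mul, h2, ← α.act_mul, inv_mul_cancel, α.act_one]
    exact hγδ (inv_mul_eq_one.mp (hx _ h3))
  have := measure_iUnion₀ hdisj
    (fun γ => ((α.measurePreserving γ).measurable hW).nullMeasurableSet)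
  simp only [(α.measurePreserving _).measure_preimage hW.nullMeasurableSet,
    ENNReal.tsum_const_eq_top_of_ne_zero hne] at this
  exact measure_ne_top μ _ this

/-- A standard Borel space carries a sequence of Borel sets separating ordered pairs of points. -/
theorem exists_measurableSet_separating (X : Type) [MeasurableSpace X] [StandardBorelSpace X] :
    ∃ O : ℕ → Set X, (∀ l, MeasurableSet (O l)) ∧ ∀ x y, x ≠ y → ∃ l, x ∈ O l ∧ y ∉ O l := by
  obtain ⟨A, hA, hsep⟩ := exists_seq_separating X (p := MeasurableSet) .univ Set.univ
  refine ⟨fun l => if Even l then A (l / 2) else (A (l / 2))ᶜ, fun l => ?_, fun x y hxy => ?_⟩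
  · beta_reduce
    split_ifs
    · exact hA _
    · exact (hA _).compl
  · have : ∃ n, ¬ (x ∈ A n ↔ y ∈ A n) := by
      by_contra hcon
      push Not at hcon
      exact hxy (hsep x trivial y trivial hcon)
    obtain ⟨n, hn⟩ := this
    by_cases hx : x ∈ A n
    · exact ⟨2 * n, by simpa [hx] using hn⟩
    · have h2 : (2 * n + 1) / 2 = n := by omega
      exact ⟨2 * n + 1, by simpa [hx, h2, Nat.even_add_one] using hn⟩

/-- A CBER all of whose classes lie in orbits of a countable group. -/
def CBER.ofOrbit (Γ : Type) {X : Type} [Group Γ] [Countable Γ] [MulAction Γ X] [MeasurableSpace X]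
    (r : X → X → Prop) (hm : MeasurableSet {p : X × X | r p.1 p.2}) (he : Equivalence r)
    (hs : ∀ x y, r x y → ∃ γ : Γ, γ • x = y) : CBER X where
  dom := Set.univ
  dom_meas := .univ
  rel := r
  rel_meas := hm
  rel_dom := fun _ => ⟨trivial, trivial⟩
  refl := fun x _ => he.refl x
  symm := he.symm
  trans := he.trans
  countable_classes := fun x => (Set.countable_range fun γ : Γ => γ • x).mono (hs x)

namespace TreeMap

variable {Γ H X Y ι : Type} [Group Γ] [Group H] [MulAction Γ X] [MulAction H Y]
  [MeasurableSpace X] [MeasurableSpace Y] (T : TreeMap Γ H X Y ι)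

theorem measurable_prodMk_f [MeasurableConstSMul H Y] (h : H) :
    Measurable fun z : X => (z, h • T.f z) :=
  measurable_id.prodMk ((measurable_const_smul h).comp T.measurable_f)

variable [Countable H] [Countable ι] [Nonempty ι]

theorem Clique.equivalence (i : ι) (h : H) : Equivalence (T.Clique i h) where
  refl x := Or.inl rfl
  symm := by
    rintro x y (rfl | ⟨h1, h2, ⟨γ, rfl⟩, b, hb, h3⟩)
    · exact Or.inl rfl
    · exact Or.inr ⟨h2, h1, ⟨γ⁻¹, by simp⟩, b⁻¹, inv_mem hb, by rw [h3, inv_smul_smul]⟩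
  trans := by
    rintro x y z (rfl | ⟨h1, h2, ⟨γ, rfl⟩, b, hb, h3⟩)
    · exact id
    · rintro (rfl | ⟨-, h5, ⟨γ', rfl⟩, b', hb', h6⟩)
      · exact Or.inr ⟨h1, h2, ⟨γ, rfl⟩, b, hb, h3⟩
      · exact Or.inr ⟨h1, h5, ⟨γ' * γ, by rw [mul_smul]⟩, b' * b, mul_mem hb' hb,
          by rw [h6, h3, mul_smul]⟩

variable [Countable Γ]

/-- The oriented pieces of the graph of leaves: `γ` moves the leaf `z` to the point `z'` and `l` is
the first index such that `O l` separates them. -/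
def LeafStep (O : ℕ → Set X) (k : Option (ι × H)) (γ : Γ) (l : ℕ) (z z' : X) : Prop :=
  T.leafDom k z ∧ z' = T.leafTgt k z ∧ firstOf {γ : Γ | γ • z = T.leafTgt k z} = γ ∧
    sInf {l | z ∈ O l ∧ T.leafTgt k z ∉ O l} = l

/-- The pieces of the graph of leaves. -/
def LeafRel (O : ℕ → Set X) (k : Option (ι × H)) (γ : Γ) (l : ℕ) (z z' : X) : Prop :=
  z = z' ∨ T.LeafStep O k γ l z z' ∨ T.LeafStep O k γ l z' z

variable {T} in
theorem LeafStep.smul_eq {O : ℕ → Set X} {k : Option (ι × H)} {γ : Γ} {l : ℕ} {z z' : X}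
    (h : T.LeafStep O k γ l z z') : γ • z = z' := by
  obtain ⟨-, rfl, rfl, -⟩ := h
  exact firstOf_mem (S := {γ : Γ | γ • z = T.leafTgt k z}) T.leafTgt_mem

variable {T} in
theorem LeafStep.mem {O : ℕ → Set X} (hO : ∀ x y, x ≠ y → ∃ l, x ∈ O l ∧ y ∉ O l)
    {k : Option (ι × H)} {γ : Γ} {l : ℕ} {z z' : X}
    (h : T.LeafStep O k γ l z z') : z ∈ O l ∧ z' ∉ O l := by
  obtain ⟨h1, rfl, -, rfl⟩ := h
  exact Nat.sInf_mem (s := {l | z ∈ O l ∧ T.leafTgt k z ∉ O l}) (hO _ _ (T.leafTgt_ne h1).symm)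

theorem LeafRel.equivalence {O : ℕ → Set X} (hO : ∀ x y, x ≠ y → ∃ l, x ∈ O l ∧ y ∉ O l)
    (k : Option (ι × H)) (γ : Γ) (l : ℕ) : Equivalence (T.LeafRel O k γ l) where
  refl x := Or.inl rfl
  symm := by
    rintro x y (rfl | h | h)
    · exact Or.inl rfl
    · exact Or.inr (Or.inr h)
    · exact Or.inr (Or.inl h)
  trans := by
    rintro x y z (rfl | h | h) (rfl | h' | h')
    · exact Or.inl rfl
    · exact Or.inr (Or.inl h')
    · exact Or.inr (Or.inr h')
    · exact Or.inr (Or.inl h)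
    · exact absurd (h'.mem hO).1 (h.mem hO).2
    · left
      have := h.smul_eq.trans h'.smul_eq.symm
      exact smul_left_cancel γ this
    · exact Or.inr (Or.inr h)
    · exact Or.inl (h.smul_eq.symm.trans h'.smul_eq)
    · exact absurd (h.mem hO).1 (h'.mem hO).2

section Measurability
variable [MeasurableConstSMul Γ X] [MeasurableConstSMul H Y] [StandardBorelSpace X]
  [StandardBorelSpace Y]

theorem measurableSet_Lab (i : ι) (h : H) : MeasurableSet {p : X × Y | h ∈ T.Lab i p.1 p.2} := by
  have : {p : X × Y | h ∈ T.Lab i p.1 p.2} = {p | T.proj p.1 (h • T.f p.1) = p.1} ∩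
      ⋃ b : T.B i, {p | h • T.f p.1 = (b : H) • p.2} := by
    ext p; simp [Lab]
  have hf : Measurable fun p : X × Y => h • T.f p.1 :=
    (measurable_const_smul h).comp (T.measurable_f.comp measurable_fst)
  rw [this]
  exact (measurableSet_eq_fun (T.measurable_proj.comp (measurable_fst.prodMk hf))
    measurable_fst).inter (.iUnion fun b => measurableSet_eq_fun hf
      ((measurable_const_smul (b : H)).comp measurable_snd))

theorem measurableSet_exists_Lab (i : ι) (h : H) :
    MeasurableSet {p : X × Y | ∃ γ : Γ, h ∈ T.Lab i (γ • p.1) p.2} := by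
  have : {p : X × Y | ∃ γ : Γ, h ∈ T.Lab i (γ • p.1) p.2} =
      ⋃ γ : Γ, (fun p : X × Y => (γ • p.1, p.2)) ⁻¹' {p | h ∈ T.Lab i p.1 p.2} := by
    ext p; simp
  rw [this]
  exact .iUnion fun γ => (((measurable_const_smul γ).comp measurable_fst).prodMk measurable_snd)
    (T.measurableSet_Lab i h)

theorem measurableSet_Central (i : ι) (h : H) : MeasurableSet {z | T.Central i h z} :=
  (measurableSet_eq_fun (T.measurable_proj.comp (T.measurable_prodMk_f h)) measurable_id).inter
    ((T.measurable_prodMk_f h) (measurableSet_firstOf_eq (T.measurableSet_exists_Lab i) h))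

theorem measurableSet_orbit : MeasurableSet {p : X × X | ∃ γ : Γ, γ • p.1 = p.2} := by
  have : {p : X × X | ∃ γ : Γ, γ • p.1 = p.2} = ⋃ γ : Γ, {p | γ • p.1 = p.2} := by
    ext p; simp
  rw [this]
  exact .iUnion fun γ => measurableSet_eq_fun ((measurable_const_smul γ).comp measurable_fst)
    measurable_snd

theorem measurableSet_Clique (i : ι) (h : H) :
    MeasurableSet {p : X × X | T.Clique i h p.1 p.2} := by
  have : {p : X × X | T.Clique i h p.1 p.2} = {p | p.1 = p.2} ∪
      (Prod.fst ⁻¹' {z | T.Central i h z} ∩ (Prod.snd ⁻¹' {z | T.Central i h z} ∩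
      ({p | ∃ γ : Γ, γ • p.1 = p.2} ∩
        ⋃ b : T.B i, {p | h • T.f p.2 = (b : H) • h • T.f p.1}))) := by
    ext p; simp [Clique]
  have hf : Measurable fun z : X => h • T.f z := (measurable_const_smul h).comp T.measurable_f
  rw [this]
  exact (measurableSet_eq_fun measurable_fst measurable_snd).union
    ((measurable_fst (T.measurableSet_Central i h)).inter
    ((measurable_snd (T.measurableSet_Central i h)).inter
    (measurableSet_orbit.inter (.iUnion fun b => measurableSet_eq_fun (hf.comp measurable_snd)
      ((measurable_const_smul (b : H)).comp (hf.comp measurable_fst))))))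

theorem measurableSet_leafDom (k : Option (ι × H)) : MeasurableSet {z | T.leafDom k z} := by
  rcases k with _ | ⟨i, h⟩
  · exact (measurableSet_eq_fun (T.measurable_proj.comp (measurable_id.prodMk T.measurable_f))
      measurable_id).compl
  · exact (measurableSet_eq_fun (T.measurable_proj.comp (T.measurable_prodMk_f h))
      measurable_id).inter ((T.measurable_prodMk_f h (measurableSet_firstOf_eq
        (P := fun (p : X × Y) h => h ∈ T.Lab i p.1 p.2) (T.measurableSet_Lab i) h)).inter
      (T.measurable_prodMk_f h (measurableSet_of_firstOf
        (P := fun (p : X × Y) h => ∃ γ : Γ, h ∈ T.Lab i (γ • p.1) p.2)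
        (Q := fun p h => h ∈ T.Lab i p.1 p.2) (T.measurableSet_exists_Lab i)
        (T.measurableSet_Lab i))).compl)

theorem measurable_leafTgt (k : Option (ι × H)) : Measurable (T.leafTgt k) := by
  rcases k with _ | ⟨i, h⟩
  · exact T.measurable_proj.comp (measurable_id.prodMk T.measurable_f)
  · refine measurable_of_firstOf
      (P := fun z (γ : Γ) => T.mlab i z (h • T.f z) ∈ T.Lab i (γ • z) (h • T.f z))
      (F := fun z γ => γ • z) (fun γ => ?_) (fun γ => measurable_const_smul γ)
    exact T.measurable_prodMk_f h (measurableSet_of_firstOf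
        (P := fun (p : X × Y) h => ∃ γ : Γ, h ∈ T.Lab i (γ • p.1) p.2)
        (Q := fun p h => h ∈ T.Lab i (γ • p.1) p.2) (T.measurableSet_exists_Lab i)
        fun h => (((measurable_const_smul γ).comp measurable_fst).prodMk measurable_snd)
          (T.measurableSet_Lab i h))

theorem measurableSet_LeafStep {O : ℕ → Set X} (hO : ∀ l, MeasurableSet (O l))
    (k : Option (ι × H)) (γ : Γ) (l : ℕ) :
    MeasurableSet {p : X × X | T.LeafStep O k γ l p.1 p.2} := by
  refine (measurable_fst (T.measurableSet_leafDom k)).inter ((measurableSet_eq_fun measurable_snd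
    ((T.measurable_leafTgt k).comp measurable_fst)).inter ((measurable_fst
      (measurableSet_firstOf_eq (P := fun z (γ : Γ) => γ • z = T.leafTgt k z)
        (fun γ => measurableSet_eq_fun (measurable_const_smul γ) (T.measurable_leafTgt k)) γ)).inter
      (measurable_fst (measurable_sInf_nat (P := fun z l => z ∈ O l ∧ T.leafTgt k z ∉ O l)
        (fun l => (hO l).inter ((T.measurable_leafTgt k) (hO l)).compl) (.singleton l)))))

theorem measurableSet_LeafRel {O : ℕ → Set X} (hO : ∀ l, MeasurableSet (O l))
    (k : Option (ι × H)) (γ : Γ) (l : ℕ) :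
    MeasurableSet {p : X × X | T.LeafRel O k γ l p.1 p.2} :=
  (measurableSet_eq_fun measurable_fst measurable_snd).union
    ((T.measurableSet_LeafStep hO k γ l).union
      (measurable_swap (T.measurableSet_LeafStep hO k γ l)))

variable (Γ X) in
/-- The orbit equivalence relation of a Borel action. -/
def orbitCBER : CBER X := CBER.ofOrbit Γ (fun x y => ∃ γ : Γ, γ • x = y) measurableSet_orbit
  { refl := fun x => ⟨1, one_smul _ _⟩
    symm := by
      rintro x y ⟨γ, rfl⟩
      exact ⟨γ⁻¹, inv_smul_smul _ _⟩
    trans := by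
      rintro x y z ⟨γ, rfl⟩ ⟨δ, rfl⟩
      exact ⟨δ * γ, mul_smul _ _ _⟩ } fun _ _ h => h

/-- The members of the free product decomposition of the orbit equivalence relation associated
with `T`. -/
def piece {O : ℕ → Set X} (hO : ∀ l, MeasurableSet (O l))
    (hO' : ∀ x y, x ≠ y → ∃ l, x ∈ O l ∧ y ∉ O l) :
    (ι × H) ⊕ (Option (ι × H) × Γ × ℕ) → CBER X
  | .inl (i, h) => CBER.ofOrbit Γ (T.Clique i h) (T.measurableSet_Clique i h)
      (Clique.equivalence T i h) (by
        rintro x y (rfl | ⟨-, -, h, -⟩)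
        · exact ⟨1, one_smul _ _⟩
        · exact h)
  | .inr (k, γ, l) => CBER.ofOrbit Γ (T.LeafRel O k γ l) (T.measurableSet_LeafRel hO k γ l)
      (LeafRel.equivalence T hO' k γ l) (by
        rintro x y (rfl | h | h)
        · exact ⟨1, one_smul _ _⟩
        · exact ⟨γ, h.smul_eq⟩
        · exact ⟨γ⁻¹, by rw [← h.smul_eq, inv_smul_smul]⟩)

theorem freelyIndep_piece {O : ℕ → Set X} (hO : ∀ l, MeasurableSet (O l))
    (hO' : ∀ x y, x ≠ y → ∃ l, x ∈ O l ∧ y ∉ O l) : FreelyIndep (T.piece hO hO') := by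
  classical
  refine freelyIndep_of_retractions _ ?_
  rintro (⟨i, h⟩ | ⟨k, γ, l⟩) x
  · obtain ⟨r, h1, h2, h3⟩ := T.exists_clique_ret i h x
    refine ⟨r, h1, ?_⟩
    rintro (⟨j, h'⟩ | ⟨k, γ, l⟩) u u' huu' hne
    · exact h2 j h' u u' huu' (by rintro rfl rfl; exact hne rfl)
    · rcases huu' with rfl | ⟨hd, rfl, -⟩ | ⟨hd, rfl, -⟩
      · rfl
      · exact h3 k u hd
      · exact (h3 k u' hd).symm
  · have hstep : ∀ z z', T.LeafStep O k γ l z z' → ∃ r : X → X, r z = z ∧ r z' = z' ∧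
        ∀ j u u', (T.piece hO hO' j).rel u u' →
          (j = .inr (k, γ, l) → ¬ T.LeafRel O k γ l z u) → r u = r u' := by
      intro z z' hz
      obtain ⟨side, h1, h2, h3, h4⟩ := T.exists_leaf_side hz.1
      have hz' := hz.2.1
      refine ⟨fun u => if side u then z else z', if_pos h1, if_neg (hz' ▸ h2), ?_⟩
      have hleaf : ∀ k' γ' l' u u', T.LeafStep O k' γ' l' u u' →
          ((k', γ', l') = (k, γ, l) → ¬ T.LeafRel O k γ l z u) → (side u ↔ side u') := by
        rintro k' γ' l' u u' hu hne
        obtain ⟨h5, rfl, h6, h7⟩ := hu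
        refine h4 k' u h5 ?_
        rintro ⟨rfl, rfl⟩
        obtain ⟨-, -, h8, h9⟩ := hz
        exact hne (by rw [← h6, ← h7, ← h8, ← h9]) (Or.inl rfl)
      rintro (⟨j, h'⟩ | ⟨k', γ', l'⟩) u u' huu' hne
      · simp only [h3 j h' u u' huu']
      · rcases huu' with rfl | hu | hu
        · rfl
        · simp only [hleaf k' γ' l' u u' hu fun h => hne (by rw [h])]
        · have := hleaf k' γ' l' u' u hu fun h h' => by
            refine hne (by rw [h]) ?_
            simp only [Prod.mk.injEq] at h
            obtain ⟨rfl, rfl, rfl⟩ := h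
            exact (LeafRel.equivalence T hO' _ _ _).trans h' (Or.inr (Or.inl hu))
          simp only [this]
    have hdich : (∀ u, T.LeafRel O k γ l x u → u = x) ∨ ∃ z z', T.LeafStep O k γ l z z' ∧
        T.LeafRel O k γ l z x := by
      by_contra hcon
      push Not at hcon
      obtain ⟨⟨u, hu, hne⟩, hcon⟩ := hcon
      rcases hu with rfl | hu | hu
      · exact hne rfl
      · exact hcon _ _ hu (Or.inl rfl)
      · exact hcon _ _ hu (Or.inr (Or.inl hu))
    rcases hdich with hx | ⟨z, z', hz, hzx⟩
    · exact ⟨fun _ => x, fun u hu => (hx u hu).symm, fun _ _ _ _ _ => rfl⟩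
    · obtain ⟨r, h1, h2, h3⟩ := hstep z z' hz
      have heq := LeafRel.equivalence T hO' k γ l
      refine ⟨r, ?_, fun j u u' huu' hne => h3 j u u' huu' fun hj hzu =>
        hne hj (heq.trans (heq.symm hzx) hzu)⟩
      intro u hu
      rcases heq.trans hzx hu with rfl | hu | hu
      · exact h1
      · rwa [hu.2.1, ← hz.2.1]
      · exact absurd (hz.mem hO').1 (hu.mem hO').2

theorem isFreeProduct_piece {O : ℕ → Set X} (hO : ∀ l, MeasurableSet (O l))
    (hO' : ∀ x y, x ≠ y → ∃ l, x ∈ O l ∧ y ∉ O l) :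
    IsFreeProduct (orbitCBER Γ X) (T.piece hO hO') := by
  have hdom : ∀ j, (T.piece hO hO' j).dom = Set.univ := by
    rintro (⟨i, h⟩ | ⟨k, γ, l⟩) <;> rfl
  have hsub : ∀ j x y, (T.piece hO hO' j).rel x y → ∃ γ : Γ, γ • x = y := by
    rintro (⟨i, h⟩ | ⟨k, γ, l⟩) x y
    · rintro (rfl | ⟨-, -, h, -⟩)
      · exact ⟨1, one_smul _ _⟩
      · exact h
    · rintro (rfl | h | h)
      · exact ⟨1, one_smul _ _⟩
      · exact ⟨γ, h.smul_eq⟩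
      · exact ⟨γ⁻¹, by rw [← h.smul_eq, inv_smul_smul]⟩
  refine ⟨T.freelyIndep_piece hO hO', ?_, fun x y => ⟨?_, ?_⟩⟩
  · simp only [hdom]
    refine (Set.iUnion_const (ι := (ι × H) ⊕ (Option (ι × H) × Γ × ℕ)) Set.univ).symm
  · rintro ⟨γ, rfl⟩
    refine ⟨trivial, T.eqvGen_of_mem_orbit γ x ?_ ?_⟩
    · exact fun i h u u' huu' => .rel _ _ ⟨.inl (i, h), huu'⟩
    · exact fun k u hu => .rel _ _ ⟨.inr (k, _, _), Or.inr (Or.inl ⟨hu, rfl, rfl, rfl⟩)⟩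
  · rintro ⟨-, h⟩
    induction h with
    | rel x y h =>
      obtain ⟨j, hj⟩ := h
      exact hsub j x y hj
    | refl x => exact ⟨1, one_smul _ _⟩
    | symm x y _ ih => exact (orbitCBER Γ X).symm ih
    | trans x y z _ _ ih ih' => exact (orbitCBER Γ X).trans ih ih'

theorem exists_sets_of_MFI [Infinite Γ] (hΓ : MFI Γ) {μ : Measure X} [IsProbabilityMeasure μ]
    (α : PMPAction Γ X μ) (hα : α.IsFree) (hact : ∀ γ x, α.act γ x = γ • x) :
    ∃ V : ι × H → Set X, (∀ q, MeasurableSet (V q)) ∧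
      (∀ i h x (γ : Γ), x ∈ V (i, h) → γ • x ∈ V (i, h) →
        ∃ b ∈ T.B i, h • T.f (γ • x) = b • h • T.f x) ∧
      ∀ᵐ x ∂μ, ∃ q, ∃ γ : Γ, γ • x ∈ V q := by
  obtain ⟨O, hO, hO'⟩ := exists_measurableSet_separating X
  have hR : IsOrbitRel α ⊤ (orbitCBER Γ X) := by
    refine ⟨rfl, fun x y => ?_⟩
    simp only [Subgroup.mem_top, true_and, hact]
    rfl
  obtain ⟨U, C, hU, -, -, hC, hC0, hcov, -, hrel⟩ :=
    hΓ X μ α _ hα hR _ inferInstance _ (T.isFreeProduct_piece hO hO')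
  let C' : Set X := ⋂ γ : Γ, (fun x => γ • x) ⁻¹' C
  have hC' : MeasurableSet C' := .iInter fun γ => measurable_const_smul γ hC
  have hmemC : ∀ x ∈ C', ∀ γ : Γ, γ • x ∈ C' := by
    intro x hx γ
    simp only [C', Set.mem_iInter, Set.mem_preimage] at hx ⊢
    intro δ
    rw [← mul_smul]
    exact hx _
  have hCC : ∀ x ∈ C', x ∈ C := by
    intro x hx
    have := Set.mem_iInter.mp hx 1
    rwa [Set.mem_preimage, one_smul] at this
  have hpres : ∀ (γ : Γ) {E : Set X}, μ E = 0 → μ ((fun x => γ • x) ⁻¹' E) = 0 := by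
    intro γ E hE
    have h1 : α.act γ = fun x => γ • x := funext (hact γ)
    rw [← h1]
    exact (α.measurePreserving γ).quasiMeasurePreserving.preimage_null hE
  have hC'0 : ∀ᵐ x ∂μ, x ∈ C' := by
    have : ∀ᵐ x ∂μ, ∀ γ : Γ, γ • x ∈ C := ae_all_iff.mpr fun γ => hpres γ hC0
    filter_upwards [this] with x hx
    exact Set.mem_iInter.mpr hx
  have hleaf : ∀ j, μ (U (Sum.inr j) ∩ C') = 0 := by
    rintro ⟨k, γ₀, l⟩
    have hkey : ∀ x ∈ U (Sum.inr (k, γ₀, l)) ∩ C', ∀ γ : Γ,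
        γ • x ∈ U (Sum.inr (k, γ₀, l)) ∩ C' → T.LeafRel O k γ₀ l x (γ • x) :=
      fun x hx γ hγ => (hrel _ x ⟨hx.1, hCC x hx.2⟩ _ ⟨hγ.1, hCC _ hγ.2⟩).1 ⟨γ, rfl⟩
    have h1 : μ (U (Sum.inr (k, γ₀, l)) ∩ C' ∩ O l) = 0 := by
      refine α.measure_eq_zero_of_wandering hα (((hU _).inter hC').inter (hO l)) ?_
      intro x hx γ hγ
      rw [hact] at hγ ⊢
      rcases hkey x hx.1 γ hγ.1 with h | h | h
      · exact h.symm
      · exact absurd hγ.2 (h.mem hO').2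
      · exact absurd hx.2 (h.mem hO').2
    have h2 : μ (U (Sum.inr (k, γ₀, l)) ∩ C' ∩ (O l)ᶜ) = 0 := by
      refine α.measure_eq_zero_of_wandering hα (((hU _).inter hC').inter (hO l).compl) ?_
      intro x hx γ hγ
      rw [hact] at hγ ⊢
      rcases hkey x hx.1 γ hγ.1 with h | h | h
      · exact h.symm
      · exact absurd (h.mem hO').1 hx.2
      · exact absurd (h.mem hO').1 hγ.2
    rw [← measure_inter_add_sdiff _ (hO l), h1, zero_add]
    exact h2
  refine ⟨fun q => U (Sum.inl q) ∩ C', fun q => (hU _).inter hC', ?_, ?_⟩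
  · intro i h x γ hx hγ
    rcases (hrel _ x ⟨hx.1, hCC x hx.2⟩ _ ⟨hγ.1, hCC _ hγ.2⟩).1 ⟨γ, rfl⟩ with h | ⟨-, -, -, h⟩
    · rw [← h]
      exact ⟨1, one_mem _, (one_smul _ _).symm⟩
    · exact h
  · have hnl : ∀ᵐ x ∂μ, ∀ j, ∀ γ : Γ, γ • x ∉ U (Sum.inr j) ∩ C' := by
      refine ae_all_iff.mpr fun j => ae_all_iff.mpr fun γ => ?_
      have h := hpres γ (hleaf j)
      exact measure_eq_zero_iff_ae_notMem.mp h
    filter_upwards [hC'0, hnl] with x hx hn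
    obtain ⟨y, hy, γ, rfl⟩ := hcov x ⟨trivial, hCC x hx⟩
    obtain ⟨j, hj⟩ := Set.mem_iUnion.mp hy
    rcases j with q | j
    · exact ⟨q, γ, hj, hmemC x hx γ⟩
    · exact absurd ⟨hj, hmemC x hx γ⟩ (hn j γ)

end Measurability

end TreeMap

namespace PMPAction

variable {G X : Type} [Group G] [MeasurableSpace X] {μ : Measure X}

/-- The underlying action of a p.m.p. action. -/
abbrev toMulAction (α : PMPAction G X μ) : MulAction G X where
  smul := α.act
  one_smul := α.act_one
  mul_smul := α.act_mul

theorem act_inv_act (α : PMPAction G X μ) (g : G) (x : X) : α.act g⁻¹ (α.act g x) = x := by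
  rw [← α.act_mul, inv_mul_cancel, α.act_one]

theorem act_act_inv (α : PMPAction G X μ) (g : G) (x : X) : α.act g (α.act g⁻¹ x) = x := by
  rw [← α.act_mul, mul_inv_cancel, α.act_one]

theorem measurable_act (α : PMPAction G X μ) (g : G) : Measurable (α.act g) :=
  (α.measurePreserving g).measurable

/-- The pull-back of a p.m.p. action under a group homomorphism. -/
def comap {Γ : Type} [Group Γ] (α : PMPAction G X μ) (φ : Γ →* G) : PMPAction Γ X μ where
  act γ := α.act (φ γ)
  act_one x := by rw [map_one, α.act_one]
  act_mul γ δ x := by rw [map_mul, α.act_mul]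
  measurePreserving γ := α.measurePreserving (φ γ)

theorem IsFree.comap {Γ : Type} [Group Γ] {α : PMPAction G X μ} (hα : α.IsFree) {φ : Γ →* G}
    (hφ : Function.Injective φ) : (α.comap φ).IsFree := by
  filter_upwards [hα] with x hx γ hγ
  exact (map_eq_one_iff φ hφ).mp (hx _ hγ)

theorem ae_act [Countable G] (α : PMPAction G X μ) {P : X → Prop} (h : ∀ᵐ x ∂μ, P x) :
    ∀ᵐ x ∂μ, ∀ g, P (α.act g x) :=
  ae_all_iff.mpr fun g => (α.measurePreserving g).quasiMeasurePreserving.ae h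

/-- Every conull set contains an invariant Borel conull set. -/
theorem exists_invariant_conull [Countable G] (α : PMPAction G X μ) {P : X → Prop}
    (h : ∀ᵐ x ∂μ, P x) : ∃ S : Set X, MeasurableSet S ∧ μ Sᶜ = 0 ∧ (∀ x ∈ S, P x) ∧
      ∀ x ∈ S, ∀ g, α.act g x ∈ S := by
  obtain ⟨N, hN, hNm, hN0⟩ := exists_measurable_superset_of_null h
  have hae : ∀ᵐ x ∂μ, x ∉ N := measure_eq_zero_iff_ae_notMem.mp hN0
  refine ⟨⋂ g, α.act g ⁻¹' Nᶜ, .iInter fun g => α.measurable_act g hNm.compl, ?_, ?_, ?_⟩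
  · have := α.ae_act hae
    refine measure_mono_null ?_ this
    intro x hx hcon
    exact hx (Set.mem_iInter.mpr hcon)
  · intro x hx
    have := Set.mem_iInter.mp hx 1
    rw [Set.mem_preimage, α.act_one] at this
    by_contra hcon
    exact this (hN hcon)
  · intro x hx g
    refine Set.mem_iInter.mpr fun g' => ?_
    have := Set.mem_iInter.mp hx (g' * g)
    rwa [Set.mem_preimage, α.act_mul] at this

/-- The restriction of a p.m.p. action to an invariant conull Borel set. -/
def restrict (α : PMPAction G X μ) {S : Set X} (hS : MeasurableSet S)
    (hinv : ∀ x ∈ S, ∀ g, α.act g x ∈ S) :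
    PMPAction G S (μ.comap Subtype.val) where
  act g x := ⟨α.act g x, hinv x x.2 g⟩
  act_one x := Subtype.ext (α.act_one x)
  act_mul g h x := Subtype.ext (α.act_mul g h x)
  measurePreserving g := by
    have hm : Measurable fun x : S => (⟨α.act g x, hinv x x.2 g⟩ : S) :=
      ((α.measurable_act g).comp measurable_subtype_coe).subtype_mk
    refine ⟨hm, ?_⟩
    ext E hE
    have hemb := MeasurableEmbedding.subtype_coe hS
    rw [Measure.map_apply hm hE, hemb.comap_apply, hemb.comap_apply]
    have h1 : MeasurableSet (Subtype.val '' E) := hemb.measurableSet_image.mpr hE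
    rw [← (α.measurePreserving g).measure_preimage h1.nullMeasurableSet]
    congr 1
    ext x
    constructor
    · rintro ⟨z, hz, rfl⟩
      exact ⟨_, hz, rfl⟩
    · rintro ⟨z, hz, hzx⟩
      have hx : x ∈ S := by
        rw [← α.act_inv_act g x, ← hzx]
        exact hinv _ z.2 _
      refine ⟨⟨x, hx⟩, ?_, rfl⟩
      rw [Set.mem_preimage]
      convert hz
      exact hzx.symm

end PMPAction

/-- Orbits of a measurably freely indecomposable group, mapped into the orbits of an action of a
free product, are located in cosets of the factors. -/
theorem MFI.exists_sets {Γ H X Y ι : Type} [Group Γ] [Countable Γ] [Infinite Γ] [Group H]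
    [Countable H] [Countable ι] [Nonempty ι] [MeasurableSpace X] [StandardBorelSpace X]
    [MeasurableSpace Y] [StandardBorelSpace Y] (hΓ : MFI Γ) {μ : Measure X}
    [IsProbabilityMeasure μ] (α : PMPAction Γ X μ) (hα : α.IsFree) {ν : Measure Y}
    (β : PMPAction H Y ν) {B : ι → Subgroup H} (hB : IsFreeProductOf H B)
    {f : X → Y} {e : X → ℕ} {s : ℕ → Y → X} (hf : Measurable f) (he : Measurable e)
    (hs : ∀ n, Measurable (s n)) (hse : ∀ᵐ x ∂μ, s (e x) (f x) = x)
    (hhom : ∀ᵐ x ∂μ, ∀ γ, ∃ h, β.act h (f x) = f (α.act γ x))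
    (hfree : ∀ᵐ x ∂μ, ∀ h, β.act h (f x) = f x → h = 1) :
    ∃ V : ι × H → Set X, (∀ q, MeasurableSet (V q)) ∧
      (∀ i h x γ, x ∈ V (i, h) → α.act γ x ∈ V (i, h) →
        ∃ b ∈ B i, β.act h (f (α.act γ x)) = β.act b (β.act h (f x))) ∧
      ∀ᵐ x ∂μ, ∃ q, ∃ γ, α.act γ x ∈ V q := by
  classical
  obtain ⟨S, hS, hS0, hP, hinv⟩ := α.exists_invariant_conull (hse.and (hhom.and hfree))
  let μ₀ : Measure S := μ.comap Subtype.val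
  have hemb := MeasurableEmbedding.subtype_coe hS
  have hS1 : μ S = 1 := (prob_compl_eq_zero_iff hS).mp hS0
  have : IsProbabilityMeasure μ₀ := ⟨by
    rw [hemb.comap_apply, Set.image_univ, Subtype.range_coe, hS1]⟩
  have : StandardBorelSpace S := hS.standardBorel
  obtain ⟨x₀, hx₀⟩ : S.Nonempty := nonempty_of_measure_ne_zero (μ := μ) (by simp [hS1])
  let α₀ : PMPAction Γ S μ₀ := α.restrict hS hinv
  let : MulAction Γ S := α₀.toMulAction
  let : MulAction H Y := β.toMulAction
  have : MeasurableConstSMul Γ S := ⟨fun γ => α₀.measurable_act γ⟩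
  have : MeasurableConstSMul H Y := ⟨fun h => β.measurable_act h⟩
  have hsmem : ∀ n y, (if s n y ∈ S then s n y else x₀) ∈ S := by
    intro n y
    split_ifs with h
    · exact h
    · exact hx₀
  let T : TreeMap Γ H S Y ι :=
    { B := B
      freeProduct := hB
      f := fun x => f x
      e := fun x => e x
      s := fun n y => ⟨if s n y ∈ S then s n y else x₀, hsmem n y⟩
      measurable_f := hf.comp measurable_subtype_coe
      measurable_e := he.comp measurable_subtype_coe
      measurable_s := fun n => (Measurable.ite (hs n hS) (hs n) measurable_const).subtype_mk
      s_eq := fun x => by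
        have hx := (hP x x.2).1
        refine Subtype.ext ?_
        change (if s (e x) (f x) ∈ S then s (e x) (f x) else x₀) = x
        rw [hx, if_pos x.2]
      hom := fun γ x => (hP x x.2).2.1 γ
      free := fun h x hh => (hP x x.2).2.2 h hh }
  have hfree₀ : α₀.IsFree := by
    have : ∀ᵐ x : S ∂μ₀, ∀ g, α.act g (x : X) = x → g = 1 := by
      rw [ae_iff, hemb.comap_apply]
      refine measure_mono_null ?_ hα
      rintro _ ⟨x, hx, rfl⟩
      exact hx
    filter_upwards [this] with x hx g hg
    exact hx g (congrArg Subtype.val hg)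
  obtain ⟨V, hV, h1, h2⟩ := T.exists_sets_of_MFI hΓ α₀ hfree₀ fun _ _ => rfl
  refine ⟨fun q => Subtype.val '' V q, fun q => hemb.measurableSet_image.mpr (hV q), ?_, ?_⟩
  · rintro i h _ γ ⟨x, hx, rfl⟩ ⟨x', hx', hxx'⟩
    have heq : x' = γ • x := Subtype.ext hxx'
    rw [heq] at hx'
    exact h1 i h x γ hx hx'
  · rw [ae_iff, hemb.comap_apply] at h2
    have h3 : ∀ᵐ x ∂μ, x ∈ S := hS0
    filter_upwards [h3, measure_eq_zero_iff_ae_notMem.mp h2] with x hx hx'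
    by_contra hcon
    refine hx' ⟨⟨x, hx⟩, ?_, rfl⟩
    rintro ⟨q, γ, hq⟩
    exact hcon ⟨q, γ, _, hq, rfl⟩

/-- A stable orbit equivalence can be reversed. -/
def SOEquiv.symm {X Y : Type} [MeasurableSpace X] [MeasurableSpace Y] {R : CBER X} {μ : Measure X}
    {S : CBER Y} {ν : Measure Y} (E : SOEquiv R μ S ν) (hB : ν E.B ≠ ⊤) : SOEquiv S ν R μ where
  A := E.B
  B := E.A
  toFun := E.invFun
  invFun := E.toFun
  measA := E.measB
  measB := E.measA
  A_sub := E.B_sub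
  B_sub := E.A_sub
  A_pos := E.B_pos
  B_pos := E.A_pos
  A_section := E.B_section
  B_section := E.A_section
  meas_toFun := E.meas_invFun
  meas_invFun := E.meas_toFun
  mapsTo := E.mapsTo_inv
  mapsTo_inv := E.mapsTo
  left_inv := E.right_inv
  right_inv := E.left_inv
  measure_eq F hFB hF := by
    have h1 : E.invFun '' F = E.A ∩ E.toFun ⁻¹' F := by
      ext x
      constructor
      · rintro ⟨y, hy, rfl⟩
        refine ⟨E.mapsTo_inv (hFB hy), ?_⟩
        rw [Set.mem_preimage, E.right_inv y (hFB hy)]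
        exact hy
      · rintro ⟨hx, hx'⟩
        exact ⟨_, hx', E.left_inv x hx⟩
    have h2 : E.toFun '' (E.invFun '' F) = F := by
      ext y
      constructor
      · rintro ⟨_, ⟨z, hz, rfl⟩, rfl⟩
        rwa [E.right_inv z (hFB hz)]
      · intro hy
        exact ⟨_, ⟨y, hy, rfl⟩, E.right_inv y (hFB hy)⟩
    have hm : MeasurableSet (E.invFun '' F) := h1 ▸ E.measA.inter (E.meas_toFun hF)
    rw [E.measure_eq _ (by rw [h1]; exact Set.inter_subset_left) hm, h2]
  rel_iff := by
    obtain ⟨C, hC, hC0, h⟩ := E.rel_iff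
    refine ⟨E.invFun ⁻¹' C, E.meas_invFun hC, ?_, ?_⟩
    · have h1 : E.toFun '' (E.A \ C) = E.B \ E.invFun ⁻¹' C := by
        ext y
        constructor
        · rintro ⟨x, ⟨hx, hxC⟩, rfl⟩
          refine ⟨E.mapsTo hx, ?_⟩
          rwa [Set.mem_preimage, E.left_inv x hx]
        · rintro ⟨hy, hyC⟩
          exact ⟨_, ⟨E.mapsTo_inv hy, hyC⟩, E.right_inv y hy⟩
      have h2 := E.measure_eq _ Set.sdiff_subset (E.measA.diff hC)
      rw [hC0, mul_zero, h1] at h2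
      exact (mul_eq_zero.mp h2.symm).resolve_left (ENNReal.inv_ne_zero.mpr hB)
    · rintro y ⟨hy, hyC⟩ z ⟨hz, hzC⟩
      have := h _ ⟨E.mapsTo_inv hy, hyC⟩ _ ⟨E.mapsTo_inv hz, hzC⟩
      rw [E.right_inv y hy, E.right_inv z hz] at this
      exact this.symm

/-- A Borel map sending the orbits of a p.m.p. action into orbits of another one, countable-to-one
with a Borel enumeration of its sections, and compatible with the measures. -/
structure OrbitMap {G H X Y : Type} [Group G] [Group H] [MeasurableSpace X] [MeasurableSpace Y]
    {μ : Measure X} {ν : Measure Y} (α : PMPAction G X μ) (β : PMPAction H Y ν) where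
  toFun : X → Y
  code : X → ℕ
  sec : ℕ → Y → X
  const : ENNReal
  dom : Set X
  quasi : Measure.QuasiMeasurePreserving toFun μ ν
  measurable_code : Measurable code
  measurable_sec : ∀ n, Measurable (sec n)
  const_ne_top : const ≠ ⊤
  measurableSet_dom : MeasurableSet dom
  ae_mem_dom : ∀ᵐ x ∂μ, x ∈ dom
  sec_code : ∀ x ∈ dom, sec (code x) (toFun x) = x
  hom : ∀ᵐ x ∂μ, ∀ g, ∃ h, β.act h (toFun x) = toFun (α.act g x)
  free : ∀ᵐ x ∂μ, ∀ h, β.act h (toFun x) = toFun x → h = 1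
  measure_image_le : ∀ F ⊆ dom, MeasurableSet F → ν (toFun '' F) ≤ const * μ F

theorem SOEquiv.exists_orbitMap {G H X Y : Type} [Group G] [Group H] [Countable G] [Countable H]
    [MeasurableSpace X] [MeasurableSpace Y] {μ : Measure X} {ν : Measure Y}
    [IsProbabilityMeasure μ] [IsProbabilityMeasure ν]
    {α : PMPAction G X μ} {β : PMPAction H Y ν} {R : CBER X} {S : CBER Y}
    (hβ : β.IsFree) (hR : IsOrbitRel α ⊤ R) (hS : IsOrbitRel β ⊤ S) (E : SOEquiv R μ S ν) :
    ∃ F : OrbitMap α β, ∀ᵐ x ∂μ, ∃ g, α.act g x ∈ E.A ∧ F.toFun x = E.toFun (α.act g x) := by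
  classical
  obtain ⟨j, hj⟩ := exists_injective_nat G
  have hP : ∀ g, MeasurableSet {x | α.act g x ∈ E.A} := fun g => α.measurable_act g E.measA
  let r : X → G := fun x => firstOf {g | α.act g x ∈ E.A}
  let D : Set X := {x | ∃ g, α.act g x ∈ E.A}
  have hD : MeasurableSet D := by
    have : D = ⋃ g, {x | α.act g x ∈ E.A} := by ext; simp [D]
    rw [this]
    exact .iUnion hP
  have hDr : ∀ x ∈ D, α.act (r x) x ∈ E.A := fun x hx => firstOf_mem hx
  have hDae : ∀ᵐ x ∂μ, x ∈ D := by
    filter_upwards [E.A_section] with x hx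
    obtain ⟨y, hy, hxy⟩ := hx (hR.1 ▸ Set.mem_univ x)
    obtain ⟨g, -, rfl⟩ := (hR.2 _ _).mp hxy
    exact ⟨g, hy⟩
  let c : ENNReal := ν E.B * (μ E.A)⁻¹
  have hA0 : (μ E.A)⁻¹ ≠ 0 := ENNReal.inv_ne_zero.mpr (measure_ne_top _ _)
  have hc : c ≠ ⊤ :=
    ENNReal.mul_ne_top (measure_ne_top _ _) (ENNReal.inv_ne_top.mpr E.A_pos.ne')
  have hθ : ∀ F ⊆ E.A, MeasurableSet F → ν (E.toFun '' F) = c * μ F := by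
    intro F hFA hF
    rw [mul_assoc, E.measure_eq F hFA hF, ← mul_assoc,
      ENNReal.mul_inv_cancel E.B_pos.ne' (measure_ne_top _ _), one_mul]
  let f : X → Y := fun x => E.toFun (α.act (r x) x)
  have hf : Measurable f := measurable_of_firstOf (F := fun x g => E.toFun (α.act g x)) hP
    fun g => E.meas_toFun.comp (α.measurable_act g)
  obtain ⟨C, hC, hC0, hrel⟩ := E.rel_iff
  have hCae : ∀ᵐ x ∂μ, ∀ g, α.act g x ∈ E.A → α.act g x ∈ C := by
    refine α.ae_act (P := fun x => x ∈ E.A → x ∈ C) ?_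
    filter_upwards [measure_eq_zero_iff_ae_notMem.mp hC0] with x hx hxA
    by_contra hxC
    exact hx ⟨hxA, hxC⟩
  have hq : Measure.QuasiMeasurePreserving f μ ν := by
    refine ⟨hf, Measure.AbsolutelyContinuous.mk fun N hN hN0 => ?_⟩
    rw [Measure.map_apply hf hN]
    have h1 : μ (E.A ∩ E.toFun ⁻¹' N) = 0 := by
      have h2 := E.measure_eq _ Set.inter_subset_left (E.measA.inter (E.meas_toFun hN))
      have h3 : ν (E.toFun '' (E.A ∩ E.toFun ⁻¹' N)) = 0 :=
        measure_mono_null (by rintro _ ⟨x, hx, rfl⟩; exact hx.2) hN0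
      rw [h3, mul_zero] at h2
      exact (mul_eq_zero.mp h2).resolve_left hA0
    have h4 := α.ae_act (measure_eq_zero_iff_ae_notMem.mp h1)
    rw [measure_eq_zero_iff_ae_notMem]
    filter_upwards [h4, hDae] with x hx hxD hxN
    exact hx (r x) ⟨hDr x hxD, hxN⟩
  refine ⟨⟨f, fun x => j (r x), fun n y => α.act (Function.invFun j n)⁻¹ (E.invFun y), c, D, hq,
    ?_, fun n => (α.measurable_act _).comp E.meas_invFun, hc, hD, hDae, ?_, ?_, ?_, ?_⟩, ?_⟩
  · exact measurable_of_firstOf (F := fun _ g => j g) hP fun g => measurable_const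
  · intro x hx
    change α.act (Function.invFun j (j (r x)))⁻¹ (E.invFun (E.toFun (α.act (r x) x))) = x
    rw [Function.leftInverse_invFun hj, E.left_inv _ (hDr x hx), α.act_inv_act]
  · filter_upwards [hCae, α.ae_act hDae] with x hx hxD g
    have hx1 : x ∈ D := α.act_one x ▸ hxD 1
    have h1 := hDr x hx1
    have h2 := hDr _ (hxD g)
    have h3 : α.act (r (α.act g x) * g) x ∈ C := hx _ (by rw [α.act_mul]; exact h2)
    rw [α.act_mul] at h3
    have h4 : R.rel (α.act (r x) x) (α.act (r (α.act g x)) (α.act g x)) := by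
      refine (hR.2 _ _).mpr ⟨r (α.act g x) * g * (r x)⁻¹, Subgroup.mem_top _, ?_⟩
      rw [α.act_mul, α.act_mul, α.act_inv_act]
    obtain ⟨h, -, hh⟩ := (hS.2 _ _).mp ((hrel _ ⟨h1, hx _ h1⟩ _ ⟨h2, h3⟩).mp h4)
    exact ⟨h, hh⟩
  · exact hq.ae hβ
  · intro F hFD hF
    let P : G → Set X := fun g => F ∩ {x | r x = g}
    have hPm : ∀ g, MeasurableSet (P g) := fun g => hF.inter (measurableSet_firstOf_eq hP g)
    have h1 : f '' F ⊆ ⋃ g, E.toFun '' (α.act g⁻¹ ⁻¹' P g) := by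
      rintro _ ⟨x, hx, rfl⟩
      refine Set.mem_iUnion.mpr ⟨r x, α.act (r x) x, ?_, rfl⟩
      rw [Set.mem_preimage, α.act_inv_act]
      exact ⟨hx, rfl⟩
    have h2 : ∀ g, ν (E.toFun '' (α.act g⁻¹ ⁻¹' P g)) = c * μ (P g) := by
      intro g
      rw [hθ _ _ (α.measurable_act _ (hPm g)),
        (α.measurePreserving g⁻¹).measure_preimage (hPm g).nullMeasurableSet]
      rintro x ⟨hx, hxr⟩
      have := hDr _ (hFD hx)
      rw [Set.mem_ofPred_eq] at hxr
      rwa [hxr, α.act_act_inv] at this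
    calc ν (f '' F) ≤ ∑' g, ν (E.toFun '' (α.act g⁻¹ ⁻¹' P g)) :=
          (measure_mono h1).trans (measure_iUnion_le _)
      _ = c * ∑' g, μ (P g) := by rw [← ENNReal.tsum_mul_left]; exact tsum_congr h2
      _ = c * μ (⋃ g, P g) := by
          rw [measure_iUnion _ hPm]
          intro g g' hgg'
          refine Set.disjoint_left.mpr fun x hx hx' => hgg' ?_
          exact hx.2.symm.trans hx'.2
      _ ≤ c * μ F := by
          gcongr
          exact Set.iUnion_subset fun g => Set.inter_subset_left
  · filter_upwards [hDae] with x hx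
    exact ⟨r x, hDr x hx, rfl⟩

/-- A stable orbit equivalence of free actions yields maps in both directions which are
inverse to each other up to moving points in their orbits. -/
theorem SOE.exists_orbitMaps {G H X Y : Type} [Group G] [Group H] [Countable G] [Countable H]
    [MeasurableSpace X] [MeasurableSpace Y] {μ : Measure X} {ν : Measure Y}
    [IsProbabilityMeasure μ] [IsProbabilityMeasure ν]
    {α : PMPAction G X μ} {β : PMPAction H Y ν} {R : CBER X} {S : CBER Y}
    (hα : α.IsFree) (hβ : β.IsFree) (hR : IsOrbitRel α ⊤ R) (hS : IsOrbitRel β ⊤ S)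
    (h : SOE R μ S ν) :
    ∃ (F : OrbitMap α β) (F' : OrbitMap β α),
      ∀ᵐ y ∂ν, ∃ h, F.toFun (F'.toFun y) = β.act h y := by
  obtain ⟨E⟩ := h
  obtain ⟨F, hF⟩ := E.exists_orbitMap hβ hR hS
  obtain ⟨F', hF'⟩ := (E.symm (measure_ne_top _ _)).exists_orbitMap hα hS hR
  refine ⟨F, F', ?_⟩
  obtain ⟨C, hC, hC0, hrel⟩ := E.rel_iff
  have hCae : ∀ᵐ x ∂μ, ∀ g, α.act g x ∈ E.A → α.act g x ∈ C := by
    refine α.ae_act (P := fun x => x ∈ E.A → x ∈ C) ?_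
    filter_upwards [measure_eq_zero_iff_ae_notMem.mp hC0] with x hx hxA
    by_contra hxC
    exact hx ⟨hxA, hxC⟩
  filter_upwards [hF', F'.quasi.ae hF, F'.quasi.ae hCae] with y ⟨h, hhB, hy⟩ ⟨g, hgA, hgy⟩ hyC
  change β.act h y ∈ E.B at hhB
  change F'.toFun y = E.invFun (β.act h y) at hy
  have h1 : F'.toFun y ∈ E.A := hy ▸ E.mapsTo_inv hhB
  have h2 : F'.toFun y ∈ C := by
    have := hyC 1
    rw [α.act_one] at this
    exact this h1
  have h3 := (hrel _ ⟨h1, h2⟩ _ ⟨hgA, hyC g hgA⟩).mp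
    ((hR.2 _ _).mpr ⟨g, Subgroup.mem_top _, rfl⟩)
  rw [hy, E.right_inv _ hhB, ← hy, ← hgy] at h3
  obtain ⟨k, -, hk⟩ := (hS.2 _ _).mp h3
  exact ⟨k * h, by rw [β.act_mul, hk]⟩

/-- A map moving points in orbits of a free action of a free product, and carrying orbits of an
infinite factor into orbits of a factor, preserves the orbits of that factor. -/
theorem PMPAction.ae_mem_factor {H Y ι : Type} [Group H] [Countable H] [MeasurableSpace Y]
    [StandardBorelSpace Y] {ν : Measure Y} [IsProbabilityMeasure ν] (β : PMPAction H Y ν)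
    (hβ : β.IsFree) {B : ι → Subgroup H} (hB : IsFreeProductOf H B) {k o : ι} [Infinite (B k)]
    {V : Set Y} (hV : MeasurableSet V) {ψ : Y → Y} (hψ : Measurable ψ)
    (hψo : ∀ᵐ y ∂ν, y ∈ V → ∃ w, ψ y = β.act w y)
    (hψV : ∀ y ∈ V, ∀ b ∈ B k, β.act b y ∈ V → ∃ c ∈ B o, ψ (β.act b y) = β.act c (ψ y)) :
    ∀ᵐ y ∂ν, y ∈ V → o = k ∧ ∃ w ∈ B k, ψ y = β.act w y := by
  classical
  obtain ⟨S, hS, hS0, hSf, -⟩ := β.exists_invariant_conull hβ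
  have hSae : ∀ᵐ y ∂ν, y ∈ S := hS0
  have hw : ∀ w, ¬ (o = k ∧ w ∈ B k) → ν (V ∩ S ∩ {y | ψ y = β.act w y}) = 0 := by
    intro w hw
    have hfree : (β.comap (B k).subtype).IsFree := hβ.comap (B k).subtype_injective
    refine (β.comap (B k).subtype).measure_eq_zero_of_wandering hfree
      ((hV.inter hS).inter (measurableSet_eq_fun hψ (β.measurable_act w))) ?_
    rintro y ⟨⟨hyV, hyS⟩, hy⟩ ⟨b, hb⟩ ⟨⟨hbV, -⟩, hby⟩
    change β.act b y ∈ V at hbV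
    change ψ (β.act b y) = β.act w (β.act b y) at hby
    change ψ y = β.act w y at hy
    change β.act b y = y
    obtain ⟨c, hc, hcy⟩ := hψV y hyV b hb hbV
    rw [hby, hy, ← β.act_mul, ← β.act_mul] at hcy
    have h1 : w * b = c * w := by
      have := hSf y hyS ((c * w)⁻¹ * (w * b)) (by rw [β.act_mul, hcy, β.act_inv_act])
      exact (inv_mul_eq_one.mp this).symm
    by_cases hb1 : b = 1
    · rw [hb1, β.act_one]
    · exact absurd (hB.eq_and_mem_of_conj hb hc hb1 h1) hw
  have hall : ∀ᵐ y ∂ν, ∀ w, ¬ (o = k ∧ w ∈ B k) → y ∉ V ∩ S ∩ {y | ψ y = β.act w y} := by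
    refine ae_all_iff.mpr fun w => ?_
    by_cases h : o = k ∧ w ∈ B k
    · exact Filter.Eventually.of_forall fun y hy => absurd h hy
    · filter_upwards [measure_eq_zero_iff_ae_notMem.mp (hw w h)] with y hy _ using hy
  filter_upwards [hall, hSae, hψo] with y hy hyS hyo hyV
  obtain ⟨w, hw⟩ := hyo hyV
  by_cases h : o = k ∧ w ∈ B k
  · exact ⟨h.1, w, h.2, hw⟩
  · exact absurd ⟨⟨hyV, hyS⟩, hw⟩ (hy w h)

/-- The sets of `MFI.exists_sets` saturated, with the maps into factor cosets extended. -/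
theorem MFI.exists_maps {Γ H X Y ι : Type} [Group Γ] [Countable Γ] [Infinite Γ] [Group H]
    [Countable H] [Countable ι] [Nonempty ι] [MeasurableSpace X] [StandardBorelSpace X]
    [MeasurableSpace Y] [StandardBorelSpace Y] (hΓ : MFI Γ) {μ : Measure X}
    [IsProbabilityMeasure μ] (α : PMPAction Γ X μ) (hα : α.IsFree) {ν : Measure Y}
    (β : PMPAction H Y ν) {B : ι → Subgroup H} (hB : IsFreeProductOf H B)
    {f : X → Y} {e : X → ℕ} {s : ℕ → Y → X} (hf : Measurable f) (he : Measurable e)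
    (hs : ∀ n, Measurable (s n)) (hse : ∀ᵐ x ∂μ, s (e x) (f x) = x)
    (hhom : ∀ᵐ x ∂μ, ∀ γ, ∃ h, β.act h (f x) = f (α.act γ x))
    (hfree : ∀ᵐ x ∂μ, ∀ h, β.act h (f x) = f x → h = 1) :
    ∃ (S : ι × H → Set X) (φ : ι × H → X → Y), (∀ q, MeasurableSet (S q)) ∧
      (∀ q, Measurable (φ q)) ∧ (∀ q, ∀ x ∈ S q, ∀ γ, α.act γ x ∈ S q) ∧
      (∀ q, ∀ x ∈ S q, ∀ γ, ∃ b ∈ B q.1, φ q (α.act γ x) = β.act b (φ q x)) ∧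
      (∀ q x, ∃ γ, φ q x = β.act q.2 (f (α.act γ x))) ∧ ∀ᵐ x ∂μ, ∃ q, x ∈ S q := by
  obtain ⟨V, hV, hVB, hVae⟩ := hΓ.exists_sets α hα β hB hf he hs hse hhom hfree
  have hP : ∀ q γ, MeasurableSet {x | α.act γ x ∈ V q} := fun q γ => α.measurable_act γ (hV q)
  refine ⟨fun q => {x | ∃ γ, α.act γ x ∈ V q},
    fun q x => β.act q.2 (f (α.act (firstOf {γ | α.act γ x ∈ V q}) x)), ?_, ?_, ?_, ?_, ?_, hVae⟩
  · intro q
    beta_reduce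
    rw [Set.ofPred_exists]
    exact .iUnion (hP q)
  · intro q
    exact measurable_of_firstOf (F := fun x γ => β.act q.2 (f (α.act γ x))) (hP q)
      fun γ => (β.measurable_act _).comp (hf.comp (α.measurable_act γ))
  · rintro q x ⟨δ, hδ⟩ γ
    exact ⟨δ * γ⁻¹, by rwa [← α.act_mul, inv_mul_cancel_right]⟩
  · rintro ⟨i, h⟩ x ⟨δ, hδ⟩ γ
    have h1 : α.act (firstOf {γ | α.act γ x ∈ V (i, h)}) x ∈ V (i, h) :=
      firstOf_mem (S := {γ | α.act γ x ∈ V (i, h)}) ⟨δ, hδ⟩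
    have h2 := firstOf_mem (S := {γ' | α.act γ' (α.act γ x) ∈ V (i, h)})
      ⟨δ * γ⁻¹, by rwa [Set.mem_ofPred_eq, ← α.act_mul, inv_mul_cancel_right]⟩
    rw [Set.mem_ofPred_eq] at h2
    beta_reduce
    generalize firstOf {γ | α.act γ x ∈ V (i, h)} = a at h1 ⊢
    generalize firstOf {γ' | α.act γ' (α.act γ x) ∈ V (i, h)} = a' at h2 ⊢
    have h3 : α.act a' (α.act γ x) = α.act (a' * γ * a⁻¹) (α.act a x) := by
      rw [α.act_mul, α.act_mul, α.act_inv_act]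
    rw [h3] at h2 ⊢
    exact hVB i h _ _ h1 h2
  · intro q x
    exact ⟨_, rfl⟩

/-- A partial Borel injection between p.m.p. actions which identifies the restrictions of the
orbit relations and is compatible with the measures gives a measure equivalence. -/
theorem MeasureEquivalent.of_partial_map {Γ Λ X Y : Type} [Group Γ] [Group Λ] [Countable Γ]
    [Countable Λ] [MeasurableSpace X] [StandardBorelSpace X] [MeasurableSpace Y]
    [StandardBorelSpace Y] {μ : Measure X} {ν : Measure Y} [IsProbabilityMeasure μ]
    [IsProbabilityMeasure ν] (α : PMPAction Γ X μ) (β : PMPAction Λ Y ν) (hα : α.IsFree)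
    (hβ : β.IsFree) {V : Set Y} (hV : MeasurableSet V) (hV0 : ν V ≠ 0) {l : Y → X} {l' : X → Y}
    (hl : Measure.QuasiMeasurePreserving l ν μ) (hl' : Measurable l') (hll' : ∀ y ∈ V, l' (l y) = y)
    {c : ENNReal} (hc : c ≠ ⊤) (hle : ∀ F ⊆ V, MeasurableSet F → μ (l '' F) ≤ c * ν F)
    (hΛ : ∀ y ∈ V, ∀ δ, β.act δ y ∈ V → ∃ γ, l (β.act δ y) = α.act γ (l y))
    (hΓ : ∀ y ∈ V, ∀ z ∈ V, ∀ γ, l z = α.act γ (l y) → ∃ δ, z = β.act δ y) :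
    MeasureEquivalent Γ Λ := by
  classical
  let D : Set X := {x | l' x ∈ V ∧ l (l' x) = x}
  have hD : MeasurableSet D :=
    (hl' hV).inter (measurableSet_eq_fun (hl.measurable.comp hl') measurable_id)
  have hPD : ∀ γ, MeasurableSet {x | α.act γ x ∈ D} := fun γ => α.measurable_act γ hD
  have hlD : ∀ y ∈ V, l y ∈ D := by
    intro y hy
    have := hll' y hy
    exact ⟨by rwa [this], by rw [this]⟩
  let XD : Set X := {x | ∃ γ, α.act γ x ∈ D}
  have hXD : MeasurableSet XD := by
    simp only [XD, Set.ofPred_exists]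
    exact .iUnion hPD
  let a : X → Γ := fun x => firstOf {γ | α.act γ x ∈ D}
  have ha : ∀ x ∈ XD, α.act (a x) x ∈ D := fun x hx => firstOf_mem hx
  let u : X → Y := fun x => l' (α.act (a x) x)
  have hu : Measurable u := measurable_of_firstOf (F := fun x γ => l' (α.act γ x)) hPD
    fun γ => hl'.comp (α.measurable_act γ)
  have huV : ∀ x ∈ XD, u x ∈ V := fun x hx => (ha x hx).1
  have hlu : ∀ x ∈ XD, l (u x) = α.act (a x) x := fun x hx => (ha x hx).2
  have hXDinv : ∀ γ x, α.act γ x ∈ XD ↔ x ∈ XD := by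
    intro γ x
    constructor
    · rintro ⟨δ, hδ⟩
      exact ⟨δ * γ, by rwa [α.act_mul]⟩
    · rintro ⟨δ, hδ⟩
      exact ⟨δ * γ⁻¹, by rwa [← α.act_mul, inv_mul_cancel_right]⟩
  have huΓ : ∀ x ∈ XD, ∀ γ, ∃ δ, u (α.act γ x) = β.act δ (u x) := by
    intro x hx γ
    have hx' := (hXDinv γ x).mpr hx
    refine hΓ _ (huV x hx) _ (huV _ hx') (a (α.act γ x) * γ * (a x)⁻¹) ?_
    rw [hlu x hx, hlu _ hx', α.act_mul, α.act_mul, α.act_inv_act]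
  -- null sets of `Y` pull back to null sets
  have hnull : ∀ P : Y → Prop, (∀ᵐ y ∂ν, P y) → ∀ᵐ x ∂μ, x ∈ XD → ∀ δ, P (β.act δ (u x)) := by
    intro P hP
    obtain ⟨N, hN, hNm, hN0⟩ := exists_measurable_superset_of_null (β.ae_act hP)
    have h1 : μ (l '' (V ∩ N)) = 0 := by
      refine le_antisymm ((hle _ Set.inter_subset_left (hV.inter hNm)).trans ?_) zero_le
      rw [measure_mono_null Set.inter_subset_right hN0, mul_zero]
    filter_upwards [α.ae_act (measure_eq_zero_iff_ae_notMem.mp h1)] with x hx hxD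
    by_contra hcon
    exact hx (a x) ⟨u x, ⟨huV x hxD, hN hcon⟩, hlu x hxD⟩
  let j : Λ → X → X × Y := fun δ x => (x, β.act δ (u x))
  have hj : ∀ δ, Measurable (j δ) := fun δ => measurable_id.prodMk ((β.measurable_act δ).comp hu)
  let m : Measure (X × Y) := Measure.sum fun δ => (μ.restrict XD).map (j δ)
  have hm : ∀ E, MeasurableSet E → m E = ∑' δ, μ (j δ ⁻¹' E ∩ XD) := by
    intro E hE
    rw [Measure.sum_apply _ hE]
    refine tsum_congr fun δ => ?_
    rw [Measure.map_apply (hj δ) hE, Measure.restrict_apply (hj δ hE)]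
  have hmI : ∀ E, MeasurableSet E →
      m E = ∫⁻ x, ∑' δ, (j δ ⁻¹' E ∩ XD).indicator 1 x ∂μ := by
    intro E hE
    have hE' : ∀ δ, MeasurableSet (j δ ⁻¹' E ∩ XD) := fun δ => (hj δ hE).inter hXD
    rw [hm E hE, lintegral_tsum fun δ => (measurable_one.indicator (hE' δ)).aemeasurable]
    exact tsum_congr fun δ => (lintegral_indicator_one (hE' δ)).symm
  have hmae : ∀ P : X × Y → Prop, MeasurableSet {ω | P ω} →
      (∀ᵐ x ∂μ, x ∈ XD → ∀ δ, P (j δ x)) → ∀ᵐ ω ∂m, P ω := by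
    intro P hPm hP
    refine Measure.ae_sum_iff.mpr fun δ => ?_
    rw [ae_map_iff (hj δ).aemeasurable hPm, ae_restrict_iff' hXD]
    filter_upwards [hP] with x hx hxD using hx hxD δ
  have hfst : ∀ P : X → Prop, (∀ᵐ x ∂μ, P x) → ∀ᵐ ω ∂m, P ω.1 := by
    intro P hP
    obtain ⟨N, hN, hNm, hN0⟩ := exists_measurable_superset_of_null hP
    have : ∀ᵐ ω ∂m, ω.1 ∉ N := by
      refine hmae _ (measurable_fst hNm.compl) ?_
      filter_upwards [measure_eq_zero_iff_ae_notMem.mp hN0] with x hx _ _ using hx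
    filter_upwards [this] with ω hω
    by_contra hcon
    exact hω (hN hcon)
  have hsnd : ∀ P : Y → Prop, (∀ᵐ y ∂ν, P y) → ∀ᵐ ω ∂m, P ω.2 := by
    intro P hP
    obtain ⟨N, hN, hNm, hN0⟩ := exists_measurable_superset_of_null hP
    have : ∀ᵐ ω ∂m, ω.2 ∉ N :=
      hmae _ (measurable_snd hNm.compl) (hnull _ (measure_eq_zero_iff_ae_notMem.mp hN0))
    filter_upwards [this] with ω hω
    by_contra hcon
    exact hω (hN hcon)
  have hmem : ∀ᵐ ω ∂m, ω.1 ∈ XD ∧ ∃ δ, ω = j δ ω.1 := by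
    refine hmae _ ?_ (Filter.Eventually.of_forall fun x hx δ => ⟨hx, δ, rfl⟩)
    have : {ω : X × Y | ω.1 ∈ XD ∧ ∃ δ, ω = j δ ω.1} =
        Prod.fst ⁻¹' XD ∩ ⋃ δ, {ω | ω = j δ ω.1} := by
      ext; simp
    rw [this]
    exact (measurable_fst hXD).inter (.iUnion fun δ =>
      measurableSet_eq_fun measurable_id ((hj δ).comp measurable_fst))
  let aΓ : Γ → X × Y → X × Y := fun γ ω => (α.act γ ω.1, ω.2)
  let aΛ : Λ → X × Y → X × Y := fun δ ω => (ω.1, β.act δ ω.2)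
  have haΓ : ∀ γ, Measurable (aΓ γ) := fun γ =>
    ((α.measurable_act γ).comp measurable_fst).prodMk measurable_snd
  have haΛ : ∀ δ, Measurable (aΛ δ) := fun δ =>
    measurable_fst.prodMk ((β.measurable_act δ).comp measurable_snd)
  have hmpΛ : ∀ δ, MeasurePreserving (aΛ δ) m m := by
    refine fun δ => ⟨haΛ δ, Measure.ext fun E hE => ?_⟩
    rw [Measure.map_apply (haΛ δ) hE, hm _ (haΛ δ hE), hm E hE,
      ← (Equiv.mulLeft δ).tsum_eq fun δ' => μ (j δ' ⁻¹' E ∩ XD)]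
    refine tsum_congr fun δ' => ?_
    congr 2
    ext x
    simp [j, aΛ, β.act_mul]
  have hmpΓ : ∀ γ, MeasurePreserving (aΓ γ) m m := by
    refine fun γ => ⟨haΓ γ, Measure.ext fun E hE => ?_⟩
    have hE' : ∀ δ, MeasurableSet (j δ ⁻¹' E ∩ XD) := fun δ => (hj δ hE).inter hXD
    rw [Measure.map_apply (haΓ γ) hE, hmI _ (haΓ γ hE), hmI E hE,
      ← (α.measurePreserving γ).lintegral_comp
        (Measurable.tsum fun δ => measurable_one.indicator (hE' δ))]
    refine lintegral_congr fun x => ?_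
    by_cases hx : x ∈ XD
    · obtain ⟨δ₀, hδ₀⟩ := huΓ x hx γ
      rw [← (Equiv.mulRight δ₀).tsum_eq fun δ => (j δ ⁻¹' (aΓ γ ⁻¹' E) ∩ XD).indicator 1 x]
      refine tsum_congr fun δ => ?_
      have hiff : x ∈ j (δ * δ₀) ⁻¹' (aΓ γ ⁻¹' E) ∩ XD ↔ α.act γ x ∈ j δ ⁻¹' E ∩ XD := by
        simp only [Set.mem_inter_iff, Set.mem_preimage, hXDinv, j, aΓ, hδ₀, β.act_mul]
      simp only [Equiv.coe_mulRight, Set.indicator_apply, hiff, Pi.one_apply]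
    · have hx' : α.act γ x ∉ XD := mt (hXDinv γ x).mp hx
      refine tsum_congr fun δ => ?_
      rw [Set.indicator_of_notMem fun h => hx h.2, Set.indicator_of_notMem fun h => hx' h.2]
  have hfrΓ : ∀ᵐ ω ∂m, ∀ γ, aΓ γ ω = ω → γ = 1 := by
    filter_upwards [hfst _ hα] with ω hω γ hγ
    exact hω γ (congrArg Prod.fst hγ)
  have hfrΛ : ∀ᵐ ω ∂m, ∀ δ, aΛ δ ω = ω → δ = 1 := by
    filter_upwards [hsnd _ hβ] with ω hω δ hδ
    exact hω δ (congrArg Prod.snd hδ)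
  -- the fundamental domain of `Λ`
  let DΛ : Set (X × Y) := {ω | ω.1 ∈ XD ∧ ω = j 1 ω.1}
  have hDΛ : MeasurableSet DΛ := (measurable_fst hXD).inter
    (measurableSet_eq_fun measurable_id ((hj 1).comp measurable_fst))
  have hDΛcov : ∀ᵐ ω ∂m, ∃ δ, aΛ δ ω ∈ DΛ := by
    filter_upwards [hmem] with ω ⟨hω, δ, hδ⟩
    refine ⟨δ⁻¹, hω, ?_⟩
    rw [hδ]
    simp [j, aΛ, β.act_inv_act, β.act_one]
  have hDΛval : m DΛ = μ XD := by
    rw [hm _ hDΛ, tsum_eq_single 1]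
    · congr 1
      ext x
      simp [DΛ, j]
    · intro δ hδ
      rw [measure_eq_zero_iff_ae_notMem]
      filter_upwards [hnull _ hβ] with x hx hx'
      have h1 := hx hx'.2 1 δ
      have h2 : β.act δ (u x) = β.act 1 (u x) := congrArg Prod.snd hx'.1.2
      rw [β.act_one] at h1 h2
      exact hδ (h1 h2)
  have hXD0 : μ XD ≠ 0 := by
    intro h0
    refine hV0 (measure_mono_null ?_ (hl.preimage_null h0))
    intro y hy
    exact ⟨1, by rw [α.act_one]; exact hlD y hy⟩
  -- the fundamental domain of `Γ`
  have hPV : ∀ δ, MeasurableSet {y | β.act δ y ∈ V} := fun δ => β.measurable_act δ hV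
  let YV : Set Y := {y | ∃ δ, β.act δ y ∈ V}
  have hYV : MeasurableSet YV := by
    simp only [YV, Set.ofPred_exists]
    exact .iUnion hPV
  let b : Y → Λ := fun y => firstOf {δ | β.act δ y ∈ V}
  have hb : ∀ y ∈ YV, β.act (b y) y ∈ V := fun y hy => firstOf_mem hy
  let v : Y → X := fun y => l (β.act (b y) y)
  have hv : Measurable v := measurable_of_firstOf (F := fun y δ => l (β.act δ y)) hPV
    fun δ => hl.measurable.comp (β.measurable_act δ)
  let DΓ : Set (X × Y) := {ω | ω.2 ∈ YV ∧ ω.1 = v ω.2}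
  have hDΓ : MeasurableSet DΓ := (measurable_snd hYV).inter
    (measurableSet_eq_fun measurable_fst (hv.comp measurable_snd))
  have hDΓcov : ∀ᵐ ω ∂m, ∃ γ, aΓ γ ω ∈ DΓ := by
    filter_upwards [hmem] with ω ⟨hω, δ, hδ⟩
    have hω2 : ω.2 = β.act δ (u ω.1) := congrArg Prod.snd hδ
    have hY : ω.2 ∈ YV := ⟨δ⁻¹, by rw [hω2, β.act_inv_act]; exact huV _ hω⟩
    have h1 := hb _ hY
    obtain ⟨γ, hγ⟩ := hΛ (u ω.1) (huV _ hω) (b ω.2 * δ) (by rw [β.act_mul, ← hω2]; exact h1)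
    rw [β.act_mul, ← hω2, hlu _ hω, ← α.act_mul] at hγ
    exact ⟨γ * a ω.1, hY, hγ.symm⟩
  have hDΓpos : m DΓ ≠ 0 := by
    intro h0
    have h1 : ∀ᵐ ω ∂m, False := by
      have h2 : ∀ᵐ ω ∂m, ∀ γ, aΓ γ ω ∉ DΓ := ae_all_iff.mpr fun γ =>
        (hmpΓ γ).quasiMeasurePreserving.ae (measure_eq_zero_iff_ae_notMem.mp h0)
      filter_upwards [h2, hDΓcov] with ω hω ⟨γ, hγ⟩ using hω γ hγ
    refine hXD0 (hDΛval ▸ measure_mono_null (Set.subset_univ _) ?_)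
    refine measure_mono_null ?_ h1
    exact fun ω _ h => h
  have hDΓfin : m DΓ < ⊤ := by
    let W : Λ × Λ → Set Y := fun p =>
      YV ∩ {y | b y = p.2} ∩ {y | u (v y) = β.act p.1⁻¹ y}
    have hW : ∀ p, MeasurableSet (W p) := fun p =>
      (hYV.inter (measurableSet_firstOf_eq hPV p.2)).inter
        (measurableSet_eq_fun (hu.comp hv) (β.measurable_act _))
    have hWd : Pairwise (Function.onFun (AEDisjoint ν) W) := by
      rintro ⟨δ, ε⟩ ⟨δ', ε'⟩ hne
      refine measure_mono_null ?_ hβ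
      rintro y ⟨⟨⟨-, h1⟩, h2⟩, ⟨⟨-, h1'⟩, h2'⟩⟩ hy
      refine hne (Prod.ext ?_ (h1.symm.trans h1'))
      have h3 : β.act δ⁻¹ y = β.act δ'⁻¹ y := h2.symm.trans h2'
      have h4 := hy (δ' * δ⁻¹) (by rw [β.act_mul, h3, β.act_act_inv])
      exact (mul_inv_eq_one.mp h4).symm
    have hsum : ∑' p, ν (W p) ≤ 1 := by
      rw [← measure_iUnion₀ hWd fun p => (hW p).nullMeasurableSet]
      exact prob_le_one
    have hsub : ∀ δ, μ (j δ ⁻¹' DΓ ∩ XD) ≤ ∑' ε, c * ν (W (δ, ε)) := by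
      intro δ
      have h1 : j δ ⁻¹' DΓ ∩ XD ⊆ ⋃ ε, l '' (β.act ε⁻¹ ⁻¹' W (δ, ε)) := by
        rintro x ⟨⟨hx1, hx2⟩, -⟩
        change β.act δ (u x) ∈ YV at hx1
        change x = v (β.act δ (u x)) at hx2
        refine Set.mem_iUnion.mpr ⟨b (β.act δ (u x)), _, ?_, hx2.symm⟩
        rw [Set.mem_preimage, β.act_inv_act]
        refine ⟨⟨hx1, rfl⟩, ?_⟩
        change u (v (β.act δ (u x))) = β.act δ⁻¹ (β.act δ (u x))
        rw [← hx2, β.act_inv_act]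
      refine (measure_mono h1).trans ((measure_iUnion_le _).trans
        (ENNReal.tsum_le_tsum fun ε => ?_))
      rw [← (β.measurePreserving ε⁻¹).measure_preimage (hW (δ, ε)).nullMeasurableSet]
      refine hle _ ?_ (β.measurable_act _ (hW _))
      rintro y ⟨⟨hy1, hy2⟩, -⟩
      have h2 := hb _ hy1
      change b (β.act ε⁻¹ y) = ε at hy2
      rwa [hy2, β.act_act_inv] at h2
    calc m DΓ = ∑' δ, μ (j δ ⁻¹' DΓ ∩ XD) := hm _ hDΓ
      _ ≤ ∑' δ, ∑' ε, c * ν (W (δ, ε)) := ENNReal.tsum_le_tsum hsub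
      _ = c * ∑' p, ν (W p) := by
          rw [← ENNReal.tsum_mul_left, ENNReal.tsum_prod']
      _ ≤ c * 1 := by gcongr
      _ < ⊤ := by rw [mul_one]; exact hc.lt_top
  have hsf : SigmaFinite m := by
    let N : Set (X × Y) := {ω | ∃ δ, aΛ δ ω ∈ DΛ}ᶜ
    refine Measure.sigmaFinite_of_countable
      (S := insert N (Set.range fun δ => aΛ δ ⁻¹' DΛ))
      ((Set.countable_range _).insert _) ?_ ?_
    · rintro s (rfl | ⟨δ, rfl⟩)
      · have : m N = 0 := hDΛcov
        rw [this]
        exact ENNReal.zero_lt_top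
      · rw [(hmpΛ δ).measure_preimage hDΛ.nullMeasurableSet, hDΛval]
        exact measure_lt_top _ _
    · refine Set.eq_univ_of_forall fun ω => ?_
      by_cases h : ∃ δ, aΛ δ ω ∈ DΛ
      · obtain ⟨δ, hδ⟩ := h
        exact ⟨_, Or.inr ⟨δ, rfl⟩, hδ⟩
      · exact ⟨N, Or.inl rfl, h⟩
  exact ⟨{
    Ω := X × Y
    ν := m
    sigmaFinite := hsf
    aG := aΓ
    aH := aΛ
    DG := DΓ
    DH := DΛ
    aG_one := fun ω => Prod.ext (α.act_one _) rfl
    aG_mul := fun γ γ' ω => Prod.ext (α.act_mul γ γ' _) rfl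
    aH_one := fun ω => Prod.ext rfl (β.act_one _)
    aH_mul := fun δ δ' ω => Prod.ext rfl (β.act_mul δ δ' _)
    comm := fun _ _ _ => rfl
    mp_aG := hmpΓ
    mp_aH := hmpΛ
    free_aG := hfrΓ
    free_aH := hfrΛ
    fund_DG := by
      refine ⟨hDΓ, hDΓcov, fun γ hγ => ?_⟩
      refine measure_mono_null ?_ hfrΓ
      rintro ω ⟨⟨-, h1⟩, ⟨-, h2⟩⟩ hω
      exact hγ (hω γ (Prod.ext (h2.trans h1.symm) rfl))
    fund_DH := by
      refine ⟨hDΛ, hDΛcov, fun δ hδ => ?_⟩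
      refine measure_mono_null ?_ hfrΛ
      rintro ω ⟨⟨-, h1⟩, ⟨-, h2⟩⟩ hω
      exact hδ (hω δ (h2.trans h1.symm))
    DG_pos := pos_iff_ne_zero.mpr hDΓpos
    DG_fin := hDΓfin
    DH_pos := by rw [hDΛval]; exact pos_iff_ne_zero.mpr hXD0
    DH_fin := by rw [hDΛval]; exact measure_lt_top _ _ }⟩

/-- If countably many sets cover a measure space up to a null set, one of them is not null. -/
theorem exists_measure_ne_zero_of_ae {Y ι : Type} [Countable ι] [MeasurableSpace Y] {ν : Measure Y}
    {V : Set Y} {S : ι → Set Y} (hV : ν V ≠ 0) (h : ∀ᵐ y ∂ν, y ∈ V → ∃ i, y ∈ S i) :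
    ∃ i, ν (V ∩ S i) ≠ 0 := by
  by_contra! hcon
  refine hV (measure_eq_zero_iff_ae_notMem.mpr ?_)
  filter_upwards [h, ae_all_iff.mpr fun i => measure_eq_zero_iff_ae_notMem.mp (hcon i)]
    with y hy hy' hyV
  obtain ⟨i, hi⟩ := hy hyV
  exact hy' i ⟨hyV, hi⟩

/-- For MFI non-measure-equivalent groups `Γ₁, Γ₂` and a finite index `κ ≥ 2`
subgroup `Γ'₁ ≤ Γ₁`, any SOE pair of free p.m.p. actions of `Γ₁ * Γ₂` and of
`Γ'₁ * Γ₂ * ⋯ * Γ₂` (κ copies of `Γ₂`) has non-ergodic restriction to the `Γ₂`-factor. -/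
theorem SOE_forces_nonergodic_restriction
    {Γ₁ Γ₂ : Type} [Group Γ₁] [Countable Γ₁] [Group Γ₂] [Countable Γ₂]
    [Infinite Γ₁] [Infinite Γ₂]
    (hMFI₁ : MFI Γ₁) (hMFI₂ : MFI Γ₂)
    (hnME : ¬ MeasureEquivalent Γ₁ Γ₂)
    (Γ'₁ : Subgroup Γ₁) (κ : ℕ) (hκ : 2 ≤ κ) (hindex : Γ'₁.index = κ)
    {G : Type} [Group G] [Countable G] (A₁ A₂ : Subgroup G)
    (e₁ : Γ₁ ≃* A₁) (e₂ : Γ₂ ≃* A₂)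
    (hG : IsFreeProductOf G ![A₁, A₂])
    {H : Type} [Group H] [Countable H] (B₀ : Subgroup H) (B : Fin κ → Subgroup H)
    (f₀ : ↥Γ'₁ ≃* ↥B₀) (f : ∀ i, Γ₂ ≃* ↥(B i))
    (hH : IsFreeProductOf H (fun o : Option (Fin κ) => o.elim B₀ B))
    {X Y : Type} [MeasurableSpace X] [StandardBorelSpace X]
    [MeasurableSpace Y] [StandardBorelSpace Y]
    (μ : MeasureTheory.Measure X) [MeasureTheory.IsProbabilityMeasure μ]
    (ν : MeasureTheory.Measure Y) [MeasureTheory.IsProbabilityMeasure ν]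
    (α : PMPAction G X μ) (β : PMPAction H Y ν)
    (hαfree : α.IsFree) (hβfree : β.IsFree)
    (Rα : CBER X) (Rβ : CBER Y)
    (hRα : IsOrbitRel α ⊤ Rα) (hRβ : IsOrbitRel β ⊤ Rβ)
    (hsoe : SOE Rα μ Rβ ν)
    (RA₂ : CBER X) (hRA₂ : IsOrbitRel α A₂ RA₂) :
    ¬ ErgodicCBER RA₂ μ := by
  classical
  obtain ⟨F, F', hFF'⟩ := hsoe.exists_orbitMaps hαfree hβfree hRα hRβ
  intro herg
  let j₁ : Γ₁ →* G := A₁.subtype.comp e₁.toMonoidHom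
  let j₂ : Γ₂ →* G := A₂.subtype.comp e₂.toMonoidHom
  have hj₁ : Function.Injective j₁ := A₁.subtype_injective.comp e₁.injective
  have hj₂ : Function.Injective j₂ := A₂.subtype_injective.comp e₂.injective
  have hj₁' : ∀ a ∈ A₁, ∃ γ, j₁ γ = a := fun a ha =>
    ⟨e₁.symm ⟨a, ha⟩, congrArg Subtype.val (e₁.apply_symm_apply ⟨a, ha⟩)⟩
  have hj₂' : ∀ a ∈ A₂, ∃ γ, j₂ γ = a := fun a ha =>
    ⟨e₂.symm ⟨a, ha⟩, congrArg Subtype.val (e₂.apply_symm_apply ⟨a, ha⟩)⟩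
  have hsec : ∀ᵐ x ∂μ, F.sec (F.code x) (F.toFun x) = x := by
    filter_upwards [F.ae_mem_dom] with x hx using F.sec_code x hx
  have hsec' : ∀ᵐ y ∂ν, F'.sec (F'.code y) (F'.toFun y) = y := by
    filter_upwards [F'.ae_mem_dom] with x hx using F'.sec_code x hx
  obtain ⟨S, φ, hS, hφ, hSinv, hφB, hφo, hSae⟩ := hMFI₂.exists_maps (α.comap j₂)
    (hαfree.comap hj₂) β hH F.quasi.measurable F.measurable_code F.measurable_sec hsec
    (F.hom.mono fun x hx γ => hx (j₂ γ)) F.free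
  obtain ⟨q, hq⟩ := exists_measure_ne_zero_of_ae (V := Set.univ) (by simp)
    (hSae.mono fun x hx _ => hx)
  rw [Set.univ_inter] at hq
  have hSq : ∀ᵐ x ∂μ, x ∈ S q := by
    refine (herg (S q) (hS q) fun x hx y hxy => ?_).resolve_left hq
    obtain ⟨g, hg, rfl⟩ := (hRA₂.2 _ _).mp hxy
    obtain ⟨γ, rfl⟩ := hj₂' g hg
    exact hSinv q x hx γ
  obtain ⟨k, hk⟩ : ∃ k : Fin κ, q.1 ≠ some k := by
    by_contra! hcon
    have h1 := (hcon ⟨0, by omega⟩).symm.trans (hcon ⟨1, by omega⟩)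
    simp at h1
  let i : Γ₂ →* H := (B k).subtype.comp (f k).toMonoidHom
  have hi : Function.Injective i := (B k).subtype_injective.comp (f k).injective
  have hi' : ∀ b ∈ B k, ∃ γ, i γ = b := fun b hb =>
    ⟨(f k).symm ⟨b, hb⟩, congrArg Subtype.val ((f k).apply_symm_apply ⟨b, hb⟩)⟩
  have : Infinite (B k) := (f k).toEquiv.infinite_iff.mp inferInstance
  have : Infinite ((some k : Option (Fin κ)).elim B₀ B : Subgroup H) := this
  obtain ⟨V', hV', hVA', hVae'⟩ := hMFI₂.exists_sets (β.comap i) (hβfree.comap hi) α hG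
    F'.quasi.measurable F'.measurable_code F'.measurable_sec hsec'
    (F'.hom.mono fun y hy γ => hy (i γ)) F'.free
  obtain ⟨⟨t, g₀⟩, hq'⟩ : ∃ q', ν (V' q') ≠ 0 := by
    obtain ⟨⟨q', γ⟩, h⟩ := exists_measure_ne_zero_of_ae (ν := ν) (V := Set.univ)
      (S := fun p : (Fin 2 × G) × Γ₂ => (β.comap i).act p.2 ⁻¹' V' p.1) (by simp)
      (hVae'.mono fun y ⟨q', γ, h⟩ _ => ⟨(q', γ), h⟩)
    rw [Set.univ_inter, ((β.comap i).measurePreserving γ).measure_preimage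
      (hV' q').nullMeasurableSet] at h
    exact ⟨q', h⟩
  let l : Y → X := fun y => α.act g₀ (F'.toFun y)
  have hl : Measure.QuasiMeasurePreserving l ν μ :=
    (α.measurePreserving g₀).quasiMeasurePreserving.comp F'.quasi
  have hVl : ∀ y ∈ V' (t, g₀), ∀ b ∈ B k, β.act b y ∈ V' (t, g₀) →
      ∃ a ∈ (![A₁, A₂] : Fin 2 → Subgroup G) t, l (β.act b y) = α.act a (l y) := by
    intro y hy b hb hby
    obtain ⟨γ, rfl⟩ := hi' b hb
    exact hVA' t g₀ y γ hy hby
  have key : ∀ (U : Set X) (ψ : X → Y) (o : Option (Fin κ)) (h₀ : H), MeasurableSet U →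
      Measurable ψ →
      (∀ x ∈ U, ∀ a ∈ (![A₁, A₂] : Fin 2 → Subgroup G) t,
        ∃ b ∈ o.elim B₀ B, ψ (α.act a x) = β.act b (ψ x)) →
      (∀ x, ∃ g, ψ x = β.act h₀ (F.toFun (α.act g x))) →
      ∀ᵐ y ∂ν, y ∈ V' (t, g₀) ∩ l ⁻¹' U → o = some k ∧ ∃ w ∈ B k, ψ (l y) = β.act w y := by
    intro U ψ o h₀ hU hψ hUψ hψo
    refine β.ae_mem_factor hβfree hH (k := some k) ((hV' _).inter (hl.measurable hU))
      (hψ.comp hl.measurable) ?_ ?_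
    · filter_upwards [hFF', F'.quasi.ae F.hom] with y ⟨h, hh⟩ hy _
      obtain ⟨g, hg⟩ := hψo (l y)
      obtain ⟨h', hh'⟩ := hy (g * g₀)
      refine ⟨h₀ * (h' * h), ?_⟩
      rw [hg, β.act_mul, β.act_mul, ← hh, hh', α.act_mul]
    · rintro y ⟨hy, hyU⟩ b hb ⟨hby, -⟩
      obtain ⟨a, ha, hal⟩ := hVl y hy b hb hby
      obtain ⟨c, hc, hcψ⟩ := hUψ (l y) hyU a ha
      exact ⟨c, hc, by rw [hal, hcψ]⟩
  obtain rfl | rfl : t = 0 ∨ t = 1 := by fin_cases t <;> simp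
  · obtain ⟨S₁, φ₁, hS₁, hφ₁, -, hφB₁, hφo₁, hSae₁⟩ := hMFI₁.exists_maps (α.comap j₁)
      (hαfree.comap hj₁) β hH F.quasi.measurable F.measurable_code F.measurable_sec hsec
      (F.hom.mono fun x hx γ => hx (j₁ γ)) F.free
    obtain ⟨q₁, hq₁⟩ := exists_measure_ne_zero_of_ae (S := fun q => l ⁻¹' S₁ q) hq'
      ((hl.ae hSae₁).mono fun y hy _ => hy)
    have hφA₁ : ∀ x ∈ S₁ q₁, ∀ a ∈ A₁,
        ∃ b ∈ q₁.1.elim B₀ B, φ₁ q₁ (α.act a x) = β.act b (φ₁ q₁ x) := by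
      intro x hx a ha
      obtain ⟨γ, rfl⟩ := hj₁' a ha
      exact hφB₁ q₁ x hx γ
    have hkey := key (S₁ q₁) (φ₁ q₁) q₁.1 q₁.2 (hS₁ q₁) (hφ₁ q₁) hφA₁
      fun x => (hφo₁ q₁ x).imp' j₁ fun γ hγ => hγ
    have hq₁k : q₁.1 = some k := by
      by_contra hcon
      refine hq₁ (measure_eq_zero_iff_ae_notMem.mpr ?_)
      filter_upwards [hkey] with y hy hyV using hcon (hy hyV).1
    rw [hq₁k] at hφA₁
    obtain ⟨⟨w, n⟩, hpos⟩ := exists_measure_ne_zero_of_ae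
      (S := fun p : B k × ℕ => {y | φ₁ q₁ (l y) = β.act p.1 y} ∩ (F'.code ⁻¹' {p.2} ∩ F'.dom)) hq₁
      (by
        filter_upwards [hkey, F'.ae_mem_dom] with y hy hyD hyV
        obtain ⟨w, hw, hwy⟩ := (hy hyV).2
        exact ⟨(⟨w, hw⟩, F'.code y), hwy, rfl, hyD⟩)
    refine hnME (MeasureEquivalent.of_partial_map (α.comap j₁) (β.comap i) (hαfree.comap hj₁)
      (hβfree.comap hi) (l' := fun x => F'.sec n (α.act g₀⁻¹ x)) ?_ hpos hl
      ((F'.measurable_sec n).comp (α.measurable_act _)) ?_ F'.const_ne_top ?_ ?_ ?_)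
    · exact ((hV' _).inter (hl.measurable (hS₁ _))).inter
        ((measurableSet_eq_fun ((hφ₁ q₁).comp hl.measurable) (β.measurable_act _)).inter
          ((F'.measurable_code (measurableSet_singleton n)).inter F'.measurableSet_dom))
    · rintro y ⟨-, -, hyn, hyD⟩
      have := F'.sec_code y hyD
      rw [show F'.code y = n from hyn] at this
      rw [α.act_inv_act, this]
    · intro E hEV hE
      have h1 : l '' E = α.act g₀⁻¹ ⁻¹' (F'.toFun '' E) := by
        ext x
        constructor
        · rintro ⟨y, hy, rfl⟩
          exact ⟨y, hy, (α.act_inv_act _ _).symm⟩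
        · rintro ⟨y, hy, hyx⟩
          exact ⟨y, hy, by rw [show l y = α.act g₀ (F'.toFun y) from rfl, hyx, α.act_act_inv]⟩
      rw [h1]
      exact ((α.measurePreserving g₀⁻¹).measure_preimage_le _).trans
        (F'.measure_image_le E (fun y hy => (hEV hy).2.2.2) hE)
    · rintro y ⟨⟨hy, -⟩, -⟩ δ ⟨⟨hδ, -⟩, -⟩
      obtain ⟨a, ha, hal⟩ := hVl y hy (i δ) (f k δ).2 hδ
      obtain ⟨γ, rfl⟩ := hj₁' a ha
      exact ⟨γ, hal⟩
    · rintro y ⟨⟨-, hyS⟩, hyw, -⟩ z ⟨-, hzw, -⟩ γ hγ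
      obtain ⟨b, hb, hbφ⟩ := hφA₁ (l y) hyS (j₁ γ) (e₁ γ).2
      have h1 : β.act w z = β.act b (β.act w y) := by
        rw [← show φ₁ q₁ (l z) = β.act w z from hzw, ← show φ₁ q₁ (l y) = β.act w y from hyw,
          ← hbφ]
        exact congrArg _ hγ
      obtain ⟨δ, hδ⟩ := hi' ((w : H)⁻¹ * b * w) ((B k).mul_mem ((B k).mul_mem
        ((B k).inv_mem w.2) hb) w.2)
      refine ⟨δ, ?_⟩
      change z = β.act (i δ) y
      rw [hδ, β.act_mul, β.act_mul, ← h1, β.act_inv_act]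
  · have hkey := key (S q) (φ q) q.1 q.2 (hS q) (hφ q)
      (fun x hx a ha => by
        obtain ⟨γ, rfl⟩ := hj₂' a ha
        exact hφB q x hx γ)
      fun x => (hφo q x).imp' j₂ fun γ hγ => hγ
    refine hq' (measure_eq_zero_iff_ae_notMem.mpr ?_)
    filter_upwards [hkey, hl.ae hSq] with y hy hyS hyV
    exact hk (hy ⟨hyV, hyS⟩).1
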